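/- arXiv:2404.07923 — 11 statements merged into one kernel-verified Lean document; each statement's English description precedes it below -/
import Mathlib

section
/- For all t₁, t₂ > 0 and every e ∈ (0,1), the strict inequality B(t₁+2e, t₂+2(1-e)) · B(t₁,t₂) > B(t₁+e, t₂+(1-e))² holds. Consequently, for fixed a, b > 0 and e ∈ (0,1), the ratio R(n) = B(a+(n+1)e, b+(n+1)(1-e)) / B(a+ne, b+n(1-e)) is strictly increasing in n ∈ ℕ. -/
open Real MeasureTheory

/-- The Beta function `B(a,b) = ∫₀¹ t^(a-1) (1-t)^(b-1) dt`. -/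
noncomputable def betaFn (a b : ℝ) : ℝ :=
  ∫ t in (0:ℝ)..1, t ^ (a - 1) * (1 - t) ^ (b - 1)

lemma bfn_int {a b : ℝ} (ha : 0 < a) (hb : 0 < b) :
    IntervalIntegrable (fun t : ℝ => t ^ (a - 1) * (1 - t) ^ (b - 1)) volume 0 1 := by
  have h := (Complex.betaIntegral_convergent (u := a) (v := b) (by simpa) (by simpa)).norm
  refine h.congr_uIoo ?_
  intro t ht
  rw [Set.uIoo_of_le zero_le_one] at ht
  have h1 : 0 < t := ht.1
  have h2 : 0 < 1 - t := by linarith [ht.2]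
  have e2 : (1 - (t:ℂ)) = ((1 - t : ℝ) : ℂ) := by push_cast; rfl
  simp only [norm_mul]
  rw [e2, Complex.norm_cpow_eq_rpow_re_of_pos h1, Complex.norm_cpow_eq_rpow_re_of_pos h2]
  simp

lemma bfn_pos {a b : ℝ} (ha : 0 < a) (hb : 0 < b) : 0 < betaFn a b := by
  refine intervalIntegral.intervalIntegral_pos_of_pos_on (bfn_int ha hb) ?_ zero_lt_one
  intro t ht
  have h1 : 0 < t := ht.1
  have h2 : 0 < 1 - t := by linarith [ht.2]
  positivity

lemma bfn_cs (e : ℝ) (he0 : 0 < e) (he1 : e < 1) (a b : ℝ) (ha : 0 < a) (hb : 0 < b) :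
    betaFn (a + e) (b + (1 - e)) ^ 2 <
        betaFn (a + 2 * e) (b + 2 * (1 - e)) * betaFn a b := by
  have he : 0 < 1 - e := by linarith
  have i0 := bfn_int ha hb
  have i1 := bfn_int (a := a + e) (b := b + (1 - e)) (by linarith) (by linarith)
  have i2 := bfn_int (a := a + 2 * e) (b := b + 2 * (1 - e)) (by linarith) (by linarith)
  have p0 := bfn_pos ha hb
  have p1 := bfn_pos (a := a + e) (b := b + (1 - e)) (by linarith) (by linarith)
  set c := betaFn (a + e) (b + (1 - e)) / betaFn a b with hc
  have hcpos : 0 < c := div_pos p1 p0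
  let F : ℝ → ℝ := fun t => t ^ (a + 2 * e - 1) * (1 - t) ^ (b + 2 * (1 - e) - 1)
    - 2 * c * (t ^ (a + e - 1) * (1 - t) ^ (b + (1 - e) - 1))
    + c ^ 2 * (t ^ (a - 1) * (1 - t) ^ (b - 1))
  have iF : IntervalIntegrable F volume 0 1 :=
    (i2.sub (i1.const_mul _)).add (i0.const_mul _)
  have vF : ∫ t in (0:ℝ)..1, F t = betaFn (a + 2 * e) (b + 2 * (1 - e))
      - 2 * c * betaFn (a + e) (b + (1 - e)) + c ^ 2 * betaFn a b := by
    simp only [F]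
    rw [intervalIntegral.integral_add (i2.sub (i1.const_mul _)) (i0.const_mul _),
      intervalIntegral.integral_sub i2 (i1.const_mul _),
      intervalIntegral.integral_const_mul, intervalIntegral.integral_const_mul]
    rfl
  have eF : ∀ t ∈ Set.Ioo (0:ℝ) 1,
      F t = t ^ (a - 1) * (1 - t) ^ (b - 1) * (t ^ e * (1 - t) ^ (1 - e) - c) ^ 2 := by
    intro t ht
    have h1 : 0 < t := ht.1
    have h2 : 0 < 1 - t := by linarith [ht.2]
    simp only [F]
    rw [show a + 2 * e - 1 = (a - 1) + e + e by ring, show a + e - 1 = (a - 1) + e by ring,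
      show b + 2 * (1 - e) - 1 = (b - 1) + (1 - e) + (1 - e) by ring,
      show b + (1 - e) - 1 = (b - 1) + (1 - e) by ring]
    simp only [rpow_add h1 (a - 1 + e) e, rpow_add h1 (a - 1) e,
      rpow_add h2 (b - 1 + (1 - e)) (1 - e), rpow_add h2 (b - 1) (1 - e)]
    ring
  have pF : 0 < ∫ t in (0:ℝ)..1, F t := by
    rw [intervalIntegral.integral_of_le zero_le_one, integral_Ioc_eq_integral_Ioo]
    have iF' : IntegrableOn F (Set.Ioo 0 1) :=
      ((intervalIntegrable_iff_integrableOn_Ioc_of_le zero_le_one).1 iF).mono_set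
        Set.Ioo_subset_Ioc_self
    rw [setIntegral_pos_iff_support_of_nonneg_ae _ iF']
    · let U : Set ℝ := {t | t ^ e * (1 - t) ^ (1 - e) ≠ c}
      have hU : IsOpen U := by
        have : Continuous (fun t : ℝ => t ^ e * (1 - t) ^ (1 - e)) :=
          (continuous_id.rpow_const (fun _ => Or.inr he0.le)).mul
            ((continuous_const.sub continuous_id).rpow_const (fun _ => Or.inr he.le))
        exact isOpen_ne_fun this continuous_const
      have h0 : (0:ℝ) ∈ U := by
        simp only [U, Set.mem_setOf_eq, zero_rpow he0.ne', zero_mul]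
        exact hcpos.ne
      have hne : (U ∩ Set.Ioo 0 1).Nonempty := by
        refine mem_closure_iff.1 ?_ U hU h0
        rw [closure_Ioo zero_ne_one]
        simp
      refine lt_of_lt_of_le ((hU.inter isOpen_Ioo).measure_pos volume hne) (measure_mono ?_)
      rintro t ⟨htU, ht⟩
      refine ⟨?_, ht⟩
      rw [Function.mem_support, eF t ht]
      have h1 : 0 < t := ht.1
      have h2 : 0 < 1 - t := by linarith [ht.2]
      have h3 : t ^ e * (1 - t) ^ (1 - e) - c ≠ 0 := sub_ne_zero.2 htU
      positivity
    · refine (ae_restrict_iff' measurableSet_Ioo).2 (Filter.Eventually.of_forall ?_)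
      intro t ht
      rw [eF t ht]
      have h1 : 0 < t := ht.1
      have h2 : 0 < 1 - t := by linarith [ht.2]
      simp only [Pi.zero_apply]
      positivity
  rw [vF] at pF
  have hcb : c * betaFn a b = betaFn (a + e) (b + (1 - e)) := by
    rw [hc]; field_simp
  rw [← hcb] at pF ⊢
  nlinarith [mul_pos pF p0]

/-- For all `t₁, t₂ > 0` and `e ∈ (0,1)`,
`B(t₁+2e, t₂+2(1-e)) * B(t₁,t₂) > B(t₁+e, t₂+(1-e))²`; consequently, for fixed
`a, b > 0` the ratio `R(n) = B(a+(n+1)e, b+(n+1)(1-e)) / B(a+ne, b+n(1-e))`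
is strictly increasing in `n : ℕ`. -/
theorem betaFn_ratio_strictMono (e : ℝ) (he0 : 0 < e) (he1 : e < 1) :
    (∀ t₁ t₂ : ℝ, 0 < t₁ → 0 < t₂ →
      betaFn (t₁ + e) (t₂ + (1 - e)) ^ 2 <
        betaFn (t₁ + 2 * e) (t₂ + 2 * (1 - e)) * betaFn t₁ t₂) ∧
    (∀ a b : ℝ, 0 < a → 0 < b →
      StrictMono (fun n : ℕ =>
        betaFn (a + ((n : ℝ) + 1) * e) (b + ((n : ℝ) + 1) * (1 - e)) /
          betaFn (a + (n : ℝ) * e) (b + (n : ℝ) * (1 - e)))) := by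
  refine ⟨bfn_cs e he0 he1, fun a b ha hb => strictMono_nat_of_lt_succ fun n => ?_⟩
  have he : 0 < 1 - e := by linarith
  have hA : 0 < a + (n : ℝ) * e := by positivity
  have hB : 0 < b + (n : ℝ) * (1 - e) := by positivity
  have h := bfn_cs e he0 he1 _ _ hA hB
  have p0 := bfn_pos hA hB
  have p1 := bfn_pos (a := a + (n : ℝ) * e + e) (b := b + (n : ℝ) * (1 - e) + (1 - e))
    (by linarith) (by linarith)
  push_cast
  rw [show a + ((n : ℝ) + 1) * e = a + (n : ℝ) * e + e by ring,
    show b + ((n : ℝ) + 1) * (1 - e) = b + (n : ℝ) * (1 - e) + (1 - e) by ring,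
    show a + ((n : ℝ) + 1 + 1) * e = a + (n : ℝ) * e + 2 * e by ring,
    show b + ((n : ℝ) + 1 + 1) * (1 - e) = b + (n : ℝ) * (1 - e) + 2 * (1 - e) by ring,
    div_lt_div_iff₀ p0 p1, ← pow_two]
  exact h
end

section
/- For all a, b > 0 and every e ∈ (0,1), the limit as n → ∞ (n ranging over the natural numbers) of the ratio B(a+(n+1)e, b+(n+1)(1-e)) / B(a+ne, b+n(1-e)) equals e^e · (1-e)^{1-e}. -/
open Real MeasureTheory Filter

lemma betaFn_eq {u v : ℝ} (hu : 0 < u) (hv : 0 < v) :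
    betaFn u v = Gamma u * Gamma v / Gamma (u + v) := by
  have h := Complex.betaIntegral_eq_Gamma_mul_div (u : ℂ) (v : ℂ) (by simpa) (by simpa)
  have h2 : Complex.betaIntegral (u : ℂ) (v : ℂ) = ((betaFn u v : ℝ) : ℂ) := by
    unfold Complex.betaIntegral betaFn
    rw [← intervalIntegral.integral_ofReal]
    refine intervalIntegral.integral_congr fun x hx => ?_
    rw [Set.uIcc_of_le zero_le_one] at hx
    have h1 : 0 ≤ x := hx.1
    have h3 : 0 ≤ 1 - x := by linarith [hx.2]
    push_cast [Complex.ofReal_cpow h1, Complex.ofReal_cpow h3]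
    rfl
  rw [h2, ← Complex.ofReal_add, Complex.Gamma_ofReal, Complex.Gamma_ofReal,
    Complex.Gamma_ofReal] at h
  exact_mod_cast h

lemma gamma_upper {x e : ℝ} (hx : 0 < x) (he0 : 0 < e) (he1 : e < 1) :
    Gamma (x + e) ≤ x ^ e * Gamma x := by
  have h := Gamma_mul_add_mul_le_rpow_Gamma_mul_rpow_Gamma hx (by linarith : 0 < x + 1)
    (by linarith : 0 < 1 - e) he0 (by ring)
  rw [Gamma_add_one hx.ne', mul_rpow hx.le (Gamma_pos_of_pos hx).le] at h
  have h2 : Gamma x ^ (1 - e) * (x ^ e * Gamma x ^ e) = x ^ e * Gamma x := by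
    rw [mul_left_comm, ← rpow_add (Gamma_pos_of_pos hx)]
    simp
  rw [h2] at h
  convert h using 2
  ring

lemma gamma_ratio (e : ℝ) (he0 : 0 < e) (he1 : e < 1) :
    Tendsto (fun x : ℝ => Gamma (x + e) / (x ^ e * Gamma x)) atTop (nhds 1) := by
  have hlim : Tendsto (fun x : ℝ => (1 - e / (x + e)) ^ (1 - e)) atTop (nhds 1) := by
    have h1 : Tendsto (fun x : ℝ => 1 - e / (x + e)) atTop (nhds (1 - 0)) :=
      tendsto_const_nhds.sub
        (tendsto_const_nhds.div_atTop (tendsto_atTop_add_const_right _ _ tendsto_id))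
    have h2 := h1.rpow_const (p := 1 - e) (Or.inl (by norm_num))
    simpa using h2
  refine tendsto_of_tendsto_of_tendsto_of_le_of_le' hlim tendsto_const_nhds ?_ ?_
  · filter_upwards [eventually_gt_atTop 0] with x hx
    have hG := Gamma_pos_of_pos hx
    have hxe : 0 < x + e := by linarith
    have h := gamma_upper hxe (by linarith : 0 < 1 - e) (by linarith)
    rw [show x + e + (1 - e) = x + 1 by ring, Gamma_add_one hx.ne'] at h
    have hp : 0 < (x + e) ^ (1 - e) := rpow_pos_of_pos hxe _
    have hq : 0 < x ^ e := rpow_pos_of_pos hx _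
    rw [show 1 - e / (x + e) = x / (x + e) by field_simp; ring, div_rpow hx.le hxe.le,
      div_le_div_iff₀ hp (mul_pos hq hG)]
    calc x ^ (1 - e) * (x ^ e * Gamma x) = x * Gamma x := by
          rw [← mul_assoc, ← rpow_add hx]; simp
      _ ≤ _ := by linarith
  · filter_upwards [eventually_gt_atTop 0] with x hx
    have hG := Gamma_pos_of_pos hx
    exact (div_le_one (mul_pos (rpow_pos_of_pos hx _) hG)).2 (gamma_upper hx he0 he1)

lemma lin_ratio (a c e : ℝ) (hc : 0 < c) :
    Tendsto (fun n : ℕ => (a + (n : ℝ) * e) / (c + n)) atTop (nhds e) := by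
  have h : Tendsto (fun n : ℕ => e + (a - e * c) / (c + (n : ℝ))) atTop (nhds (e + 0)) :=
    tendsto_const_nhds.add (tendsto_const_nhds.div_atTop
      (tendsto_atTop_add_const_left _ _ tendsto_natCast_atTop_atTop))
  rw [add_zero] at h
  refine h.congr fun n => ?_
  have : c + (n : ℝ) ≠ 0 := by positivity
  field_simp
  ring

/-- The ratio `B(a+(n+1)e, b+(n+1)(1-e)) / B(a+ne, b+n(1-e))` tends to
`e^e (1-e)^(1-e)` as `n → ∞`. -/
theorem betaFn_ratio_tendsto (a b e : ℝ) (ha : 0 < a) (hb : 0 < b)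
    (he0 : 0 < e) (he1 : e < 1) :
    Tendsto (fun n : ℕ =>
        betaFn (a + ((n : ℝ) + 1) * e) (b + ((n : ℝ) + 1) * (1 - e)) /
          betaFn (a + (n : ℝ) * e) (b + (n : ℝ) * (1 - e)))
      atTop (nhds (e ^ e * (1 - e) ^ (1 - e))) := by
  have hf0 : 0 < 1 - e := by linarith
  have top : ∀ a e : ℝ, 0 < e → Tendsto (fun n : ℕ => a + (n : ℝ) * e) atTop atTop :=
    fun a e he => tendsto_atTop_add_const_left _ _
      (tendsto_natCast_atTop_atTop.atTop_mul_const he)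
  have t1 := (gamma_ratio e he0 he1).comp (top a e he0)
  have t2 := (gamma_ratio (1 - e) hf0 (by linarith)).comp (top b (1 - e) hf0)
  have t3 := (lin_ratio a (a + b) e (by positivity)).rpow_const (p := e) (Or.inl he0.ne')
  have t4 := (lin_ratio b (a + b) (1 - e) (by positivity)).rpow_const (p := 1 - e)
    (Or.inl hf0.ne')
  have t := (t1.mul t2).mul (t3.mul t4)
  rw [one_mul, one_mul] at t
  refine t.congr fun n => ?_
  simp only [Function.comp]
  have hx : 0 < a + (n : ℝ) * e := by positivity
  have hy : 0 < b + (n : ℝ) * (1 - e) := by positivity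
  have hs : 0 < a + b + (n : ℝ) := by positivity
  rw [show a + ((n : ℝ) + 1) * e = a + n * e + e by ring,
    show b + ((n : ℝ) + 1) * (1 - e) = b + n * (1 - e) + (1 - e) by ring,
    betaFn_eq hx hy, betaFn_eq (by linarith) (by linarith),
    show a + n * e + e + (b + n * (1 - e) + (1 - e)) = (a + b + (n : ℝ)) + 1 by ring,
    show a + n * e + (b + n * (1 - e)) = a + b + (n : ℝ) by ring,
    Gamma_add_one hs.ne', div_rpow hx.le hs.le, div_rpow hy.le hs.le]
  have hss : (a + b + (n : ℝ)) ^ e * (a + b + (n : ℝ)) ^ (1 - e) = a + b + (n : ℝ) := by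
    rw [← rpow_add hs]; simp
  have g1 := Gamma_pos_of_pos hx
  have g2 := Gamma_pos_of_pos hy
  have g3 := Gamma_pos_of_pos hs
  have p1 := rpow_pos_of_pos hx e
  have p2 := rpow_pos_of_pos hy (1 - e)
  rw [div_mul_div_comm (_ ^ e), hss]
  generalize Gamma (a + n * e + e) = A
  generalize Gamma (b + n * (1 - e) + (1 - e)) = B
  generalize Gamma (a + n * e) = C at *
  generalize Gamma (b + n * (1 - e)) = D at *
  generalize Gamma (a + b + n) = E at *
  generalize (a + n * e) ^ e = P at *
  generalize (b + n * (1 - e)) ^ (1 - e) = Q at *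
  generalize a + b + (n : ℝ) = s at *
  field_simp
end

section
/- (Proposition 1) Let a, b > 0, let e' ∈ (0,1), and let θ' satisfy 0 < θ' < e'. Then there exists a natural number N such that for all n ≥ N, F_Beta(θ'; a+ne', b+n(1-e')) - F_Beta(θ'; a+(n+1)e', b+(n+1)(1-e')) ≥ 0; that is, the sequence n ↦ F_Beta(θ'; a+ne', b+n(1-e')) is eventually nonincreasing. -/
open Real MeasureTheory

/-- The Beta CDF `F_Beta(x; a, b) = (1/B(a,b)) ∫₀ˣ t^(a-1)(1-t)^(b-1) dt`. -/
noncomputable def betaCDF (x a b : ℝ) : ℝ :=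
  (∫ t in (0:ℝ)..x, t ^ (a - 1) * (1 - t) ^ (b - 1)) / betaFn a b

lemma aux_gint (a b : ℝ) (ha : 0 < a) (hb : 0 < b) :
    IntegrableOn (fun t : ℝ => t ^ (a - 1) * (1 - t) ^ (b - 1)) (Set.Ioo 0 1) := by
  have h := Complex.betaIntegral_convergent (u := a) (v := b) (by simpa) (by simpa)
  rw [intervalIntegrable_iff_integrableOn_Ioo_of_le (by norm_num)] at h
  refine (IntegrableOn.congr_fun h.norm ?_ measurableSet_Ioo)
  intro t ht
  have h1 : (0:ℝ) < 1 - t := by linarith [ht.2]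
  have h2 : (1 - (t:ℂ)) = ((1 - t : ℝ) : ℂ) := by push_cast; rfl
  simp only [norm_mul]
  rw [h2, Complex.norm_cpow_eq_rpow_re_of_pos ht.1, Complex.norm_cpow_eq_rpow_re_of_pos h1]
  simp

lemma aux_wmono (e : ℝ) (h0 : 0 < e) (h1 : e < 1) :
    StrictMonoOn (fun t : ℝ => t ^ e * (1 - t) ^ (1 - e)) (Set.Icc 0 e) := by
  apply strictMonoOn_of_deriv_pos (convex_Icc 0 e)
  · apply Continuous.continuousOn
    exact (continuous_id.rpow_const (fun _ => Or.inr h0.le)).mul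
      ((continuous_const.sub continuous_id).rpow_const (fun _ => Or.inr (by linarith)))
  · intro t ht
    rw [interior_Icc] at ht
    have ht0 : 0 < t := ht.1
    have ht1 : 0 < 1 - t := by linarith [ht.2]
    have d1 : HasDerivAt (fun t : ℝ => t ^ e) (e * t ^ (e - 1)) t :=
      Real.hasDerivAt_rpow_const (Or.inl ht0.ne')
    have d2 : HasDerivAt (fun t : ℝ => (1 - t) ^ (1 - e))
        (-1 * (1 - e) * (1 - t) ^ (1 - e - 1)) t :=
      ((hasDerivAt_id t).const_sub 1).rpow_const (Or.inl ht1.ne')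
    have d3 : HasDerivAt (fun t : ℝ => t ^ e * (1 - t) ^ (1 - e)) _ t := d1.mul d2
    rw [d3.deriv]
    have e1 : t ^ e = t ^ (e - 1) * t := by
      rw [Real.rpow_sub_one ht0.ne']; field_simp
    have e2 : (1 - t) ^ (1 - e) = (1 - t) ^ (1 - e - 1) * (1 - t) := by
      rw [Real.rpow_sub_one ht1.ne' (1 - e)]; field_simp
    rw [e1, e2]
    have p1 : 0 < t ^ (e - 1) := Real.rpow_pos_of_pos ht0 _
    have p2 : 0 < (1 - t) ^ (1 - e - 1) := Real.rpow_pos_of_pos ht1 _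
    have := mul_pos (mul_pos p1 p2) (sub_pos.2 ht.2)
    nlinarith [this]

lemma aux_pt (a b e t : ℝ) (n : ℕ) (ht0 : 0 < t) (ht1 : t < 1) :
    t ^ (a + (n : ℝ) * e - 1) * (1 - t) ^ (b + (n : ℝ) * (1 - e) - 1) =
      (t ^ (a - 1) * (1 - t) ^ (b - 1)) * (t ^ e * (1 - t) ^ (1 - e)) ^ n := by
  have h1 : 0 < 1 - t := by linarith
  rw [mul_pow, ← Real.rpow_mul_natCast ht0.le, ← Real.rpow_mul_natCast h1.le,
    show a + (n : ℝ) * e - 1 = (a - 1) + e * n by ring,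
    show b + (n : ℝ) * (1 - e) - 1 = (b - 1) + (1 - e) * n by ring,
    Real.rpow_add ht0, Real.rpow_add h1]
  ring

/-- Weighted moments: abstract core. -/
lemma aux_core (g w : ℝ → ℝ) (θ e : ℝ) (hθ0 : 0 < θ) (hθ : θ < e) (he1 : e < 1)
    (hg : IntegrableOn g (Set.Ioo 0 1)) (hg0 : ∀ t ∈ Set.Ioo (0:ℝ) 1, 0 < g t)
    (hw : Continuous w) (hw0 : ∀ t ∈ Set.Ioo (0:ℝ) 1, 0 < w t)
    (hmono : StrictMonoOn w (Set.Icc 0 e)) :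
    ∃ N : ℕ, ∀ n : ℕ, N ≤ n →
      (∫ t in Set.Ioo 0 θ, g t * w t ^ (n + 1)) / (∫ t in Set.Ioo 0 1, g t * w t ^ (n + 1)) ≤
      (∫ t in Set.Ioo 0 θ, g t * w t ^ n) / (∫ t in Set.Ioo 0 1, g t * w t ^ n) := by
  have hint : ∀ f : ℝ → ℝ, Continuous f → IntegrableOn (fun t => g t * f t) (Set.Ioo 0 1) := by
    intro f hf
    have hg' := (integrableOn_Icc_iff_integrableOn_Ioo).2 hg
    exact (hg'.mul_continuousOn hf.continuousOn isCompact_Icc).mono_set Set.Ioo_subset_Icc_self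
  have hi : ∀ n : ℕ, IntegrableOn (fun t => g t * w t ^ n) (Set.Ioo 0 1) :=
    fun n => hint _ (hw.pow n)
  set B : ℕ → ℝ := fun n => ∫ t in Set.Ioo 0 1, g t * w t ^ n with hB
  set c := w θ with hc
  have hc0 : 0 < c := hw0 θ ⟨hθ0, by linarith⟩
  obtain ⟨s, hs1, hs2⟩ := exists_between hθ
  have hcs : c < w s := hmono ⟨hθ0.le, hθ.le⟩ ⟨by linarith, hs2.le⟩ hs1
  have hsub : Set.Ioo s e ⊆ Set.Ioo (0:ℝ) 1 := Set.Ioo_subset_Ioo (by linarith) he1.le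
  set m := ∫ t in Set.Ioo s e, g t with hm
  have hm0 : 0 < m := by
    rw [hm, ← integral_Ioc_eq_integral_Ioo, ← intervalIntegral.integral_of_le hs2.le]
    apply intervalIntegral.intervalIntegral_pos_of_pos_on _ (fun t ht => hg0 t (hsub ht)) hs2
    rw [intervalIntegrable_iff_integrableOn_Ioo_of_le hs2.le]
    exact hg.mono_set hsub
  have hlow : ∀ n, m * w s ^ n ≤ B n := by
    intro n
    calc m * w s ^ n = ∫ t in Set.Ioo s e, g t * w s ^ n := by rw [integral_mul_const]
      _ ≤ ∫ t in Set.Ioo s e, g t * w t ^ n := by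
        apply setIntegral_mono_on ((hg.mono_set hsub).mul_const _) ((hi n).mono_set hsub)
          measurableSet_Ioo
        intro t ht
        have hws : w s ≤ w t := (hmono ⟨by linarith, hs2.le⟩
          ⟨by linarith [ht.1], ht.2.le⟩ ht.1).le
        have := hg0 t (hsub ht)
        have : 0 ≤ w s := by linarith
        gcongr
      _ ≤ B n := by
        apply setIntegral_mono_set (hi n)
        · filter_upwards [ae_restrict_mem measurableSet_Ioo] with t ht
          exact mul_nonneg (hg0 t ht).le (pow_nonneg (hw0 t ht).le n)
        · exact hsub.eventuallyLE
  have hBpos : ∀ n, 0 < B n := fun n =>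
    lt_of_lt_of_le (mul_pos hm0 (pow_pos (hc0.trans hcs) n)) (hlow n)
  have hstep : ∀ n, c * (B (n+1) - c * B n) ≤ B (n+2) - c * B (n+1) := by
    intro n
    have h : 0 ≤ ∫ t in Set.Ioo 0 1, (g t * w t ^ (n+2) - 2 * c * (g t * w t ^ (n+1)))
        + c^2 * (g t * w t ^ n) := by
      apply setIntegral_nonneg measurableSet_Ioo
      intro t ht
      have := mul_nonneg (mul_nonneg (hg0 t ht).le (pow_nonneg (hw0 t ht).le n))
        (sq_nonneg (w t - c))
      refine this.trans (le_of_eq ?_)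
      ring
    rw [integral_add, integral_sub, integral_const_mul, integral_const_mul] at h
    · change 0 ≤ B (n+2) - 2 * c * B (n+1) + c^2 * B n at h
      nlinarith
    · exact hi (n+2)
    · exact (hi (n+1)).const_mul _
    · exact (hi (n+2)).sub ((hi (n+1)).const_mul _)
    · exact (hi n).const_mul _
  have hex : ∃ N, 0 ≤ B (N+1) - c * B N := by
    by_contra! hcon
    have hup : ∀ n, B n ≤ c ^ n * B 0 := by
      intro n
      induction n with
      | zero => simp
      | succ k ih =>
        have := hcon k
        have := mul_le_mul_of_nonneg_left ih hc0.le
        rw [pow_succ]; nlinarith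
    obtain ⟨n, hn⟩ := pow_unbounded_of_one_lt (B 0 / m) ((one_lt_div hc0).2 hcs)
    rw [div_pow, div_lt_div_iff₀ hm0 (pow_pos hc0 n)] at hn
    have := hlow n
    have := hup n
    nlinarith
  obtain ⟨N, hN⟩ := hex
  have hall : ∀ n, N ≤ n → 0 ≤ B (n+1) - c * B n := by
    intro n hn
    induction n, hn using Nat.le_induction with
    | base => exact hN
    | succ k _ ih => exact (mul_nonneg hc0.le ih).trans (hstep k)
  refine ⟨N, fun n hn => ?_⟩
  have hsubθ : Set.Ioo 0 θ ⊆ Set.Ioo (0:ℝ) 1 := Set.Ioo_subset_Ioo le_rfl (by linarith)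
  have hI0 : 0 ≤ ∫ t in Set.Ioo 0 θ, g t * w t ^ n :=
    setIntegral_nonneg measurableSet_Ioo fun t ht =>
      mul_nonneg (hg0 t (hsubθ ht)).le (pow_nonneg (hw0 t (hsubθ ht)).le n)
  have hI : (∫ t in Set.Ioo 0 θ, g t * w t ^ (n+1)) ≤ c * ∫ t in Set.Ioo 0 θ, g t * w t ^ n := by
    rw [← integral_const_mul]
    apply setIntegral_mono_on ((hi (n+1)).mono_set hsubθ)
      (((hi n).mono_set hsubθ).const_mul c) measurableSet_Ioo
    intro t ht
    have h1 : w t ≤ c := (hmono ⟨ht.1.le, by linarith [ht.2]⟩ ⟨hθ0.le, hθ.le⟩ ht.2).le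
    have h2 : 0 ≤ g t * w t ^ n :=
      mul_nonneg (hg0 t (hsubθ ht)).le (pow_nonneg (hw0 t (hsubθ ht)).le n)
    have := mul_le_mul_of_nonneg_right h1 h2
    refine le_trans (le_of_eq ?_) this
    ring
  have h3 := hall n hn
  change _ / B (n+1) ≤ _ / B n
  rw [div_le_div_iff₀ (hBpos _) (hBpos _)]
  have h4 := mul_le_mul_of_nonneg_right hI (hBpos n).le
  have h5 := mul_nonneg hI0 h3
  nlinarith

lemma aux_conv (a b e x : ℝ) (n : ℕ) (hx0 : 0 ≤ x) (hx1 : x ≤ 1) :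
    (∫ t in (0:ℝ)..x, t ^ (a + (n : ℝ) * e - 1) * (1 - t) ^ (b + (n : ℝ) * (1 - e) - 1)) =
    ∫ t in Set.Ioo 0 x, (t ^ (a - 1) * (1 - t) ^ (b - 1)) * (t ^ e * (1 - t) ^ (1 - e)) ^ n := by
  rw [intervalIntegral.integral_of_le hx0, integral_Ioc_eq_integral_Ioo]
  apply setIntegral_congr_fun measurableSet_Ioo
  intro t ht
  exact aux_pt a b e t n ht.1 (ht.2.trans_le hx1)

/-- (Proposition 1) For `a, b > 0`, `e' ∈ (0,1)` and `0 < θ' < e'`, the sequence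
`n ↦ F_Beta(θ'; a+ne', b+n(1-e'))` is eventually nonincreasing. -/
theorem betaCDF_eventually_nonincreasing (a b e' θ' : ℝ) (ha : 0 < a) (hb : 0 < b)
    (he0 : 0 < e') (he1 : e' < 1) (hθ0 : 0 < θ') (hθ : θ' < e') :
    ∃ N : ℕ, ∀ n : ℕ, N ≤ n →
      betaCDF θ' (a + (n : ℝ) * e') (b + (n : ℝ) * (1 - e')) -
        betaCDF θ' (a + ((n : ℝ) + 1) * e') (b + ((n : ℝ) + 1) * (1 - e')) ≥ 0 := by
  have hp : ∀ p q : ℝ, ∀ t ∈ Set.Ioo (0:ℝ) 1, 0 < t ^ p * (1 - t) ^ q := fun p q t ht =>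
    mul_pos (Real.rpow_pos_of_pos ht.1 _) (Real.rpow_pos_of_pos (by linarith [ht.2]) _)
  obtain ⟨N, hN⟩ := aux_core (fun t => t ^ (a - 1) * (1 - t) ^ (b - 1))
    (fun t => t ^ e' * (1 - t) ^ (1 - e')) θ' e' hθ0 hθ he1 (aux_gint a b ha hb)
    (hp _ _)
    ((continuous_id.rpow_const (fun _ => Or.inr he0.le)).mul
      ((continuous_const.sub continuous_id).rpow_const (fun _ => Or.inr (by linarith))))
    (hp _ _) (aux_wmono e' he0 he1)
  refine ⟨N, fun n hn => ?_⟩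
  have h := hN n hn
  have hc : (n : ℝ) + 1 = ((n + 1 : ℕ) : ℝ) := by push_cast; rfl
  rw [hc]
  unfold betaCDF betaFn
  rw [aux_conv a b e' θ' n hθ0.le (by linarith), aux_conv a b e' 1 n (by norm_num) le_rfl,
    aux_conv a b e' θ' (n+1) hθ0.le (by linarith), aux_conv a b e' 1 (n+1) (by norm_num) le_rfl]
  exact sub_nonneg.2 h
end

section
/- (Theorem 1, one-arm binary case) Let a, b > 0, let n ≥ 1 be a natural number, and let θ' ∈ (0,1). Then the map e' ↦ F_Beta(θ'; a+ne', b+n(1-e')) is antitone on (0,1): for all 0 < e'₁ ≤ e'₂ < 1, F_Beta(θ'; a+ne'₂, b+n(1-e'₂)) ≤ F_Beta(θ'; a+ne'₁, b+n(1-e'₁)). Equivalently, the confidence 1 - F_Beta(θ'; a+ne', b+n(1-e')) increases monotonically as e' increases. -/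
open Real MeasureTheory

lemma betaAux_int (A B : ℝ) (hA : 0 < A) (hB : 0 < B) :
    IntervalIntegrable (fun t : ℝ => t ^ (A - 1) * (1 - t) ^ (B - 1)) volume 0 1 := by
  have h := (Complex.betaIntegral_convergent (u := (A : ℂ)) (v := (B : ℂ))
    (by simpa using hA) (by simpa using hB)).norm
  refine h.congr ?_
  intro t ht
  rw [Set.uIoc_of_le zero_le_one] at ht
  have h0 : 0 ≤ t := ht.1.le
  have h1 : 0 ≤ 1 - t := by linarith [ht.2]
  have e : (t : ℂ) ^ ((A : ℂ) - 1) * (1 - (t : ℂ)) ^ ((B : ℂ) - 1)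
      = ((t ^ (A - 1) * (1 - t) ^ (B - 1) : ℝ) : ℂ) := by
    rw [Complex.ofReal_mul, Complex.ofReal_cpow h0, Complex.ofReal_cpow h1]
    push_cast
    rfl
  show ‖(t : ℂ) ^ ((A : ℂ) - 1) * (1 - (t : ℂ)) ^ ((B : ℂ) - 1)‖ = _
  rw [e, Complex.norm_real, Real.norm_of_nonneg]
  positivity

lemma betaAux_ratio (A B d t : ℝ) (h0 : 0 < t) (h1 : t < 1) :
    t ^ (A + d - 1) * (1 - t) ^ (B - d - 1)
      = (t / (1 - t)) ^ d * (t ^ (A - 1) * (1 - t) ^ (B - 1)) := by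
  have h2 : 0 < 1 - t := by linarith
  rw [Real.div_rpow h0.le h2.le, show A + d - 1 = (A - 1) + d by ring,
    show B - d - 1 = (B - 1) - d by ring, Real.rpow_add h0, Real.rpow_sub h2]
  ring

lemma betaAux (x A B d : ℝ) (hx0 : 0 < x) (hx1 : x < 1) (hA : 0 < A) (hd : 0 ≤ d)
    (hB : 0 < B - d) : betaCDF x (A + d) (B - d) ≤ betaCDF x A B := by
  have i1 := betaAux_int A B hA (by linarith)
  have i2 := betaAux_int (A + d) (B - d) (by linarith) hB
  have sL : Set.uIcc 0 x ⊆ Set.uIcc (0:ℝ) 1 := by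
    rw [Set.uIcc_of_le hx0.le, Set.uIcc_of_le zero_le_one]
    exact Set.Icc_subset_Icc_right hx1.le
  have sU : Set.uIcc x 1 ⊆ Set.uIcc (0:ℝ) 1 := by
    rw [Set.uIcc_of_le hx1.le, Set.uIcc_of_le zero_le_one]
    exact Set.Icc_subset_Icc_left hx0.le
  have pos : ∀ A B t : ℝ, t ∈ Set.Ioo (0:ℝ) 1 → 0 < t ^ (A - 1) * (1 - t) ^ (B - 1) := by
    intro A B t ht
    have h2 : 0 < 1 - t := by linarith [ht.2]
    have := ht.1
    positivity
  have L1 := intervalIntegral.intervalIntegral_pos_of_pos_on (i1.mono_set sL)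
    (fun t ht => pos A B t ⟨ht.1, ht.2.trans hx1⟩) hx0
  have L2 := intervalIntegral.intervalIntegral_pos_of_pos_on (i2.mono_set sL)
    (fun t ht => pos _ _ t ⟨ht.1, ht.2.trans hx1⟩) hx0
  have U1 := intervalIntegral.intervalIntegral_pos_of_pos_on (i1.mono_set sU)
    (fun t ht => pos A B t ⟨hx0.trans ht.1, ht.2⟩) hx1
  have U2 := intervalIntegral.intervalIntegral_pos_of_pos_on (i2.mono_set sU)
    (fun t ht => pos _ _ t ⟨hx0.trans ht.1, ht.2⟩) hx1
  have hL : (∫ t in (0:ℝ)..x, t ^ (A + d - 1) * (1 - t) ^ (B - d - 1))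
      ≤ (x / (1 - x)) ^ d * ∫ t in (0:ℝ)..x, t ^ (A - 1) * (1 - t) ^ (B - 1) := by
    rw [← intervalIntegral.integral_const_mul]
    refine intervalIntegral.integral_mono_on_of_le_Ioo hx0.le (i2.mono_set sL)
      ((i1.mono_set sL).const_mul _) ?_
    intro t ht
    have ht1 : t < 1 := ht.2.trans hx1
    have p := pos A B t ⟨ht.1, ht1⟩
    rw [betaAux_ratio A B d t ht.1 ht1]
    have h2 : 0 < 1 - t := by linarith
    have h3 : 0 < 1 - x := by linarith
    refine mul_le_mul_of_nonneg_right (Real.rpow_le_rpow (div_nonneg ht.1.le h2.le) ?_ hd) p.le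
    rw [div_le_div_iff₀ h2 h3]
    nlinarith [ht.2]
  have hU : (x / (1 - x)) ^ d * (∫ t in x..1, t ^ (A - 1) * (1 - t) ^ (B - 1))
      ≤ ∫ t in x..1, t ^ (A + d - 1) * (1 - t) ^ (B - d - 1) := by
    rw [← intervalIntegral.integral_const_mul]
    refine intervalIntegral.integral_mono_on_of_le_Ioo hx1.le
      ((i1.mono_set sU).const_mul _) (i2.mono_set sU) ?_
    intro t ht
    have ht0 : 0 < t := hx0.trans ht.1
    have p := pos A B t ⟨ht0, ht.2⟩
    rw [betaAux_ratio A B d t ht0 ht.2]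
    have h2 : 0 < 1 - t := by linarith [ht.2]
    have h3 : 0 < 1 - x := by linarith
    refine mul_le_mul_of_nonneg_right (Real.rpow_le_rpow (div_nonneg hx0.le h3.le) ?_ hd) p.le
    rw [div_le_div_iff₀ h3 h2]
    nlinarith [ht.1]
  unfold betaCDF betaFn
  rw [← intervalIntegral.integral_add_adjacent_intervals (i1.mono_set sL) (i1.mono_set sU),
    ← intervalIntegral.integral_add_adjacent_intervals (i2.mono_set sL) (i2.mono_set sU),
    div_le_div_iff₀ (by linarith) (by linarith)]
  have k1 := mul_le_mul_of_nonneg_right hL U1.le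
  have k2 := mul_le_mul_of_nonneg_left hU L1.le
  linarith

/-- (Theorem 1, one-arm binary case) For `a,b > 0`, `n ≥ 1` and `θ' ∈ (0,1)`, the map
`e' ↦ F_Beta(θ'; a+ne', b+n(1-e'))` is antitone on `(0,1)`. -/
theorem betaCDF_antitone_in_evidence (a b θ' : ℝ) (ha : 0 < a) (hb : 0 < b)
    (n : ℕ) (hn : 1 ≤ n) (hθ0 : 0 < θ') (hθ1 : θ' < 1)
    (e₁ e₂ : ℝ) (he₁ : 0 < e₁) (h12 : e₁ ≤ e₂) (he₂ : e₂ < 1) :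
    betaCDF θ' (a + (n : ℝ) * e₂) (b + (n : ℝ) * (1 - e₂)) ≤
      betaCDF θ' (a + (n : ℝ) * e₁) (b + (n : ℝ) * (1 - e₁)) := by
  have hn0 : (0:ℝ) < n := by exact_mod_cast hn
  have h := betaAux θ' (a + n * e₁) (b + n * (1 - e₁)) (n * (e₂ - e₁)) hθ0 hθ1
    (by positivity) (mul_nonneg hn0.le (by linarith))
    (by nlinarith [mul_pos hn0 (sub_pos.2 he₂)])
  convert h using 2 <;> ring
end

section
/- (Theorem 1, two-arm count case with fixed control rate) Let a₁, b₁, a₀, b₀ > 0, let n ≥ 1 be a natural number, let ȳ₀ > 0, and let θ* ∈ ℝ. Then the map e ↦ ∬_{{(θ₁,θ₀) ∈ (0,∞)² : θ₁ - θ₀ ≤ θ*}} f_Gamma(θ₁; a₁+n(ȳ₀+e), b₁+n) · f_Gamma(θ₀; a₀+nȳ₀, b₀+n) dθ₁ dθ₀ is antitone in e on (0,∞): if 0 < e₁ ≤ e₂ then the double integral evaluated at e₂ is at most its value at e₁. -/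
open Real MeasureTheory

/-- The Gamma density with shape `α > 0` and rate `l > 0`:
`f_Gamma(t; α, l) = (l^α / Γ(α)) t^(α-1) e^(-l t)`. -/
noncomputable def gammaPDF (t α l : ℝ) : ℝ :=
  l ^ α / Real.Gamma α * (t ^ (α - 1) * Real.exp (-(l * t)))

lemma aux_int (α l : ℝ) (hα : 0 < α) (hl : 0 < l) :
    ∫ t in Set.Ioi 0, _root_.gammaPDF t α l = 1 := by
  unfold _root_.gammaPDF
  rw [integral_const_mul, Real.integral_rpow_mul_exp_neg_mul_Ioi hα hl, one_div,
    Real.inv_rpow hl.le]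
  have h1 := (Real.rpow_pos_of_pos hl α).ne'
  have h2 := (Real.Gamma_pos_of_pos hα).ne'
  field_simp

lemma aux_intOn (α l : ℝ) (hα : 0 < α) (hl : 0 < l) :
    IntegrableOn (fun t => _root_.gammaPDF t α l) (Set.Ioi 0) := by
  by_contra h
  have := aux_int α l hα hl
  rw [integral_undef h] at this
  exact zero_ne_one this

lemma aux_nonneg (t α l : ℝ) (hα : 0 < α) (hl : 0 < l) (ht : 0 < t) :
    0 ≤ _root_.gammaPDF t α l := by
  have := Real.Gamma_pos_of_pos hα
  unfold _root_.gammaPDF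
  positivity

lemma aux_ratio (α β l : ℝ) (hα : 0 < α) (hβ : 0 < β) (hl : 0 < l) (t : ℝ) (ht : 0 < t) :
    _root_.gammaPDF t β l = _root_.gammaPDF t α l *
      (l ^ β / Real.Gamma β / (l ^ α / Real.Gamma α) * t ^ (β - α)) := by
  unfold _root_.gammaPDF
  have h1 := (Real.rpow_pos_of_pos hl α).ne'
  have h2 := (Real.Gamma_pos_of_pos hα).ne'
  have h3 := (Real.Gamma_pos_of_pos hβ).ne'
  have : t ^ (β - 1) = t ^ (α - 1) * t ^ (β - α) := by
    rw [← Real.rpow_add ht]; congr 1; ring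
  rw [this]
  field_simp

lemma aux_cdf (α β l : ℝ) (hα : 0 < α) (hab : α ≤ β) (hl : 0 < l) (x : ℝ) :
    ∫ t in Set.Ioc 0 x, _root_.gammaPDF t β l ≤ ∫ t in Set.Ioc 0 x, _root_.gammaPDF t α l := by
  have hβ : 0 < β := hα.trans_le hab
  rcases le_or_gt x 0 with hx | hx
  · simp [Set.Ioc_eq_empty_of_le hx]
  have ia := aux_intOn α l hα hl
  have ib := aux_intOn β l hβ hl
  have s1 : Set.Ioc 0 x ⊆ Set.Ioi 0 := fun t ht => ht.1
  have s2 : Set.Ioi x ⊆ Set.Ioi 0 := fun t ht => hx.trans ht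
  set C := l ^ β / Real.Gamma β / (l ^ α / Real.Gamma α) with hC
  have hCp : 0 ≤ C := by
    have := Real.Gamma_pos_of_pos hα
    have := Real.Gamma_pos_of_pos hβ
    positivity
  rcases le_or_gt (C * x ^ (β - α)) 1 with h | h
  · refine setIntegral_mono_on (ib.mono_set s1) (ia.mono_set s1) measurableSet_Ioc ?_
    intro t ht
    rw [aux_ratio α β l hα hβ hl t ht.1]
    refine mul_le_of_le_one_right (aux_nonneg t α l hα hl ht.1) (le_trans ?_ h)
    exact mul_le_mul_of_nonneg_left
      (Real.rpow_le_rpow ht.1.le ht.2 (sub_nonneg.2 hab)) hCp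
  · have key : ∫ t in Set.Ioi x, _root_.gammaPDF t α l ≤
        ∫ t in Set.Ioi x, _root_.gammaPDF t β l := by
      refine setIntegral_mono_on (ia.mono_set s2) (ib.mono_set s2) measurableSet_Ioi ?_
      intro t ht
      have ht0 : 0 < t := s2 ht
      rw [aux_ratio α β l hα hβ hl t ht0]
      refine le_mul_of_one_le_right (aux_nonneg t α l hα hl ht0) (h.le.trans ?_)
      exact mul_le_mul_of_nonneg_left
        (Real.rpow_le_rpow hx.le (le_of_lt ht) (sub_nonneg.2 hab)) hCp
    have split : ∀ γ, 0 < γ → (∫ t in Set.Ioc 0 x, _root_.gammaPDF t γ l) +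
        ∫ t in Set.Ioi x, _root_.gammaPDF t γ l = 1 := by
      intro γ hγ
      have i := aux_intOn γ l hγ hl
      rw [← setIntegral_union (Set.Ioc_disjoint_Ioi le_rfl) measurableSet_Ioi
        (i.mono_set s1) (i.mono_set s2), Set.Ioc_union_Ioi_eq_Ioi hx.le, aux_int γ l hγ hl]
    linarith [split α hα, split β hβ]

lemma aux_prod (f g : ℝ → ℝ) (hf : IntegrableOn f (Set.Ioi 0)) (hg : IntegrableOn g (Set.Ioi 0))
    (S : Set (ℝ × ℝ)) (hS : MeasurableSet S) (h0 : ∀ p ∈ S, 0 < p.1 ∧ 0 < p.2) :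
    Integrable (S.indicator fun p => f p.1 * g p.2) (volume.prod volume) := by
  have h := ((hf.integrable_indicator measurableSet_Ioi).mul_prod
    (hg.integrable_indicator measurableSet_Ioi)).indicator hS
  refine h.congr (Filter.Eventually.of_forall fun p => ?_)
  by_cases hp : p ∈ S
  · simp [hp, (h0 p hp).1, (h0 p hp).2]
  · simp [hp]

/-- (Theorem 1, two-arm count case with fixed control rate) The double integral of
the product of the two posterior Gamma densities over `{θ₁ - θ₀ ≤ θ*}` is antitone
in the evidence `e` on `(0,∞)`. -/
theorem twoArm_count_antitone_in_evidence (a₁ b₁ a₀ b₀ : ℝ)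
    (ha₁ : 0 < a₁) (hb₁ : 0 < b₁) (ha₀ : 0 < a₀) (hb₀ : 0 < b₀)
    (n : ℕ) (hn : 1 ≤ n) (y₀ : ℝ) (hy₀ : 0 < y₀) (θs : ℝ) :
    AntitoneOn (fun e : ℝ =>
      ∫ p in {p : ℝ × ℝ | 0 < p.1 ∧ 0 < p.2 ∧ p.1 - p.2 ≤ θs},
        gammaPDF p.1 (a₁ + (n : ℝ) * (y₀ + e)) (b₁ + (n : ℝ)) *
          gammaPDF p.2 (a₀ + (n : ℝ) * y₀) (b₀ + (n : ℝ)))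
      (Set.Ioi 0) := by
  intro e₁ he₁ e₂ he₂ he
  have he₁' : 0 < e₁ := he₁
  have hn' : (0 : ℝ) < n := by exact_mod_cast hn
  have hl : 0 < b₁ + (n : ℝ) := by positivity
  have hl0 : 0 < b₀ + (n : ℝ) := by positivity
  have hα : 0 < a₁ + (n : ℝ) * (y₀ + e₁) := by positivity
  have hα0 : 0 < a₀ + (n : ℝ) * y₀ := by positivity
  have hab : a₁ + (n : ℝ) * (y₀ + e₁) ≤ a₁ + (n : ℝ) * (y₀ + e₂) := by gcongr
  have hβ := hα.trans_le hab
  dsimp only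
  generalize a₁ + (n : ℝ) * (y₀ + e₁) = α at *
  generalize a₁ + (n : ℝ) * (y₀ + e₂) = β at *
  generalize a₀ + (n : ℝ) * y₀ = α0 at *
  generalize b₁ + (n : ℝ) = l at *
  generalize b₀ + (n : ℝ) = l0 at *
  set S := {p : ℝ × ℝ | 0 < p.1 ∧ 0 < p.2 ∧ p.1 - p.2 ≤ θs} with hSdef
  have hS : MeasurableSet S :=
    (measurableSet_lt measurable_const measurable_fst).inter
      ((measurableSet_lt measurable_const measurable_snd).inter
        (measurableSet_le (measurable_fst.sub measurable_snd) measurable_const))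
  have h0 : ∀ p ∈ S, 0 < p.1 ∧ 0 < p.2 := fun p hp => ⟨hp.1, hp.2.1⟩
  have iα := aux_prod _ _ (aux_intOn α l hα hl) (aux_intOn α0 l0 hα0 hl0) S hS h0
  have iβ := aux_prod _ _ (aux_intOn β l hβ hl) (aux_intOn α0 l0 hα0 hl0) S hS h0
  rw [← integral_indicator hS, ← integral_indicator hS, Measure.volume_eq_prod,
    integral_prod_symm _ iα, integral_prod_symm _ iβ]
  refine integral_mono iβ.integral_prod_right iα.integral_prod_right fun y => ?_
  dsimp only
  rcases le_or_gt y 0 with hy | hy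
  · have hz : ∀ x : ℝ, (x, y) ∉ S := fun x hx => (not_lt.2 hy) hx.2.1
    simp [Set.indicator_of_notMem (hz _)]
  · have hz : ∀ γ x : ℝ, S.indicator (fun p : ℝ × ℝ => _root_.gammaPDF p.1 γ l *
        _root_.gammaPDF p.2 α0 l0) (x, y) =
        (Set.Ioc 0 (θs + y)).indicator (fun x => _root_.gammaPDF x γ l) x *
          _root_.gammaPDF y α0 l0 := by
      intro γ x
      have : (x, y) ∈ S ↔ x ∈ Set.Ioc 0 (θs + y) := by
        simp [hSdef, hy, sub_le_iff_le_add]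
      by_cases hx : x ∈ Set.Ioc 0 (θs + y)
      · rw [Set.indicator_of_mem (this.2 hx), Set.indicator_of_mem hx]
      · rw [Set.indicator_of_notMem (fun h => hx (this.1 h)), Set.indicator_of_notMem hx, zero_mul]
    simp only [hz]
    rw [integral_mul_const, integral_mul_const, integral_indicator measurableSet_Ioc,
      integral_indicator measurableSet_Ioc]
    exact mul_le_mul_of_nonneg_right (aux_cdf α β l hα hab hl _)
      (aux_nonneg y α0 l0 hα0 hl0 hy)
end

section
/- (Proposition 2) Let a₁, b₁, a₀, b₀ > 0, let e ∈ (0,1), let θ* < e be real, and fix ȳ₀ ∈ (0, 1-e). Define G(n) = ∬_{{(θ₁,θ₀) ∈ (0,1)² : θ₁ - θ₀ ≤ θ*}} f_Beta(θ₁; a₁+n(ȳ₀+e), b₁+n(1-ȳ₀-e)) · f_Beta(θ₀; a₀+nȳ₀, b₀+n(1-ȳ₀)) dθ₁ dθ₀. Then there exists a natural number N such that for all n ≥ N, G(n) - G(n+1) ≥ 0; that is, G is eventually nonincreasing in n. -/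
open Real MeasureTheory

/-- The Beta density `f_Beta(t; a, b) = t^(a-1)(1-t)^(b-1) / B(a,b)`. -/
noncomputable def betaPDF (t a b : ℝ) : ℝ :=
  t ^ (a - 1) * (1 - t) ^ (b - 1) / betaFn a b

lemma aux_key {α : Type*} [MeasurableSpace α] (ν : Measure α) (w h : α → ℝ) (A : Set α)
    (hA : MeasurableSet A) (hw : Integrable w ν) (hw0 : ∀ᵐ x ∂ν, 0 ≤ w x)
    (hm : Measurable h) (h0 : ∀ᵐ x ∂ν, 0 ≤ h x) (h1 : ∀ᵐ x ∂ν, h x ≤ 1) (c r : ℝ)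
    (hc0 : 0 ≤ c) (hcr : c < r) (hc : ∀ᵐ x ∂ν, x ∈ A → h x ≤ c)
    (hpos : 0 < ∫ x in {x | r ≤ h x}, w x ∂ν) :
    (∀ n : ℕ, 0 < ∫ x, h x ^ n * w x ∂ν) ∧ ∃ N : ℕ, ∀ n : ℕ, N ≤ n →
      (∫ x in A, h x ^ (n+1) * w x ∂ν) * (∫ x, h x ^ n * w x ∂ν) ≤
      (∫ x in A, h x ^ n * w x ∂ν) * (∫ x, h x ^ (n+1) * w x ∂ν) := by
  have hr : 0 < r := hc0.trans_lt hcr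
  have hint : ∀ n : ℕ, Integrable (fun x => h x ^ n * w x) ν := by
    intro n
    refine hw.mono ((hm.pow_const n).aestronglyMeasurable.mul hw.1) ?_
    filter_upwards [h0, h1] with x hx0 hx1
    rw [norm_mul, norm_pow, Real.norm_of_nonneg hx0]
    exact mul_le_of_le_one_left (norm_nonneg _) (pow_le_one₀ hx0 hx1)
  set R : Set α := {x | r ≤ h x} with hR
  have hRm : MeasurableSet R := measurableSet_le measurable_const hm
  have hZ : ∀ n : ℕ, 0 < ∫ x, h x ^ n * w x ∂ν := by
    intro n
    have : r ^ n * ∫ x in R, w x ∂ν ≤ ∫ x, h x ^ n * w x ∂ν := by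
      rw [← integral_indicator hRm, ← integral_const_mul]
      refine integral_mono_ae ((hw.indicator hRm).const_mul _) (hint n) ?_
      filter_upwards [h0, hw0] with x hx0 hxw
      by_cases hx : x ∈ R
      · simp only [Set.indicator_of_mem hx]
        exact mul_le_mul_of_nonneg_right (pow_le_pow_left₀ hr.le hx n) hxw
      · simp only [Set.indicator_of_notMem hx, mul_zero]
        positivity
    exact lt_of_lt_of_le (by positivity) this
  refine ⟨hZ, ?_⟩
  have hstep : ∃ N : ℕ, ∀ n : ℕ, N ≤ n →
      c * (∫ x, h x ^ n * w x ∂ν) ≤ ∫ x, h x ^ (n+1) * w x ∂ν := by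
    have ht : Filter.Tendsto (fun n : ℕ => (c / r) ^ n * (c * ∫ x, w x ∂ν)) Filter.atTop
        (nhds (0 * (c * ∫ x, w x ∂ν))) :=
      (tendsto_pow_atTop_nhds_zero_of_lt_one (by positivity)
        ((div_lt_one hr).2 hcr)).mul_const _
    rw [zero_mul] at ht
    have hp : 0 < (r - c) * ∫ x in R, w x ∂ν := mul_pos (by linarith) hpos
    obtain ⟨N, hN⟩ := Filter.eventually_atTop.1 (ht.eventually (gt_mem_nhds hp))
    refine ⟨N, fun n hn => ?_⟩
    have h2 := hN n hn
    rw [div_pow, div_mul_eq_mul_div, div_lt_iff₀ (by positivity)] at h2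
    have h3 : (r - c) * r ^ n * (∫ x in R, w x ∂ν) - c ^ n * c * (∫ x, w x ∂ν) ≤
        (∫ x, h x ^ (n+1) * w x ∂ν) - c * (∫ x, h x ^ n * w x ∂ν) := by
      rw [← integral_indicator hRm, ← integral_const_mul, ← integral_const_mul,
        ← integral_const_mul, ← integral_sub ((hw.indicator hRm).const_mul _) (hw.const_mul _),
        ← integral_sub (hint _) ((hint n).const_mul _)]
      refine integral_mono_ae (((hw.indicator hRm).const_mul _).sub (hw.const_mul _))
        ((hint _).sub ((hint n).const_mul _)) ?_
      filter_upwards [h0, hw0] with x hx0 hxw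
      have e1 : h x ^ (n+1) * w x - c * (h x ^ n * w x) = (h x - c) * h x ^ n * w x := by ring
      simp only [e1]
      by_cases hx : x ∈ R
      · simp only [Set.indicator_of_mem hx]
        have hx' : r ≤ h x := hx
        have : (r - c) * r ^ n ≤ (h x - c) * h x ^ n :=
          mul_le_mul (by linarith) (pow_le_pow_left₀ hr.le hx n) (by positivity) (by linarith)
        have h5 := mul_le_mul_of_nonneg_right this hxw
        have : 0 ≤ c ^ n * c * w x := by positivity
        linarith
      · simp only [Set.indicator_of_notMem hx, mul_zero, zero_sub]
        by_cases hxc : c ≤ h x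
        · have : 0 ≤ c ^ n * c * w x := by positivity
          have : 0 ≤ (h x - c) * h x ^ n * w x :=
            mul_nonneg (mul_nonneg (by linarith) (by positivity)) hxw
          linarith
        · push Not at hxc
          have h6 : h x ^ n ≤ c ^ n := pow_le_pow_left₀ hx0 hxc.le n
          have h7 : (c - h x) * h x ^ n ≤ c * c ^ n :=
            mul_le_mul (by linarith) h6 (by positivity) hc0
          have h8 := mul_le_mul_of_nonneg_right h7 hxw
          linarith
    nlinarith
  obtain ⟨N, hN⟩ := hstep
  refine ⟨N, fun n hn => ?_⟩
  have h4 : (∫ x in A, h x ^ (n+1) * w x ∂ν) ≤ c * ∫ x in A, h x ^ n * w x ∂ν := by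
    rw [← integral_const_mul]
    refine integral_mono_ae (hint _).integrableOn ((hint n).integrableOn.const_mul c) ?_
    refine (ae_restrict_iff' hA).2 ?_
    filter_upwards [h0, hw0, hc] with x hx0 hxw hxc hx
    have e1 : h x ^ (n+1) * w x = h x * (h x ^ n * w x) := by ring
    simp only [e1]
    exact mul_le_mul_of_nonneg_right (hxc hx) (by positivity)
  have h5 : 0 ≤ ∫ x in A, h x ^ n * w x ∂ν := by
    refine integral_nonneg_of_ae (ae_restrict_of_ae ?_)
    filter_upwards [h0, hw0] with x hx0 hxw
    simp only [Pi.zero_apply]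
    positivity
  calc _ ≤ (c * ∫ x in A, h x ^ n * w x ∂ν) * (∫ x, h x ^ n * w x ∂ν) :=
        mul_le_mul_of_nonneg_right h4 (hZ n).le
    _ = (∫ x in A, h x ^ n * w x ∂ν) * (c * ∫ x, h x ^ n * w x ∂ν) := by ring
    _ ≤ _ := mul_le_mul_of_nonneg_left (hN n hn) h5

/-- one-dimensional likelihood -/
noncomputable def auxL (p t : ℝ) : ℝ := t ^ p * (1 - t) ^ (1 - p)

lemma auxL_cont {p : ℝ} (h0 : 0 < p) (h1 : p < 1) : Continuous (auxL p) := by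
  unfold auxL
  exact (continuous_id.rpow_const (fun _ => Or.inr h0.le)).mul
    ((continuous_const.sub continuous_id).rpow_const (fun _ => Or.inr (by linarith)))

lemma auxL_nonneg {p t : ℝ} (ht : t ∈ Set.Icc (0:ℝ) 1) : 0 ≤ auxL p t :=
  mul_nonneg (Real.rpow_nonneg ht.1 _) (Real.rpow_nonneg (by linarith [ht.2]) _)

lemma auxL_le_one {p t : ℝ} (h0 : 0 < p) (h1 : p < 1) (ht : t ∈ Set.Icc (0:ℝ) 1) :
    auxL p t ≤ 1 :=
  mul_le_one₀ (Real.rpow_le_one ht.1 ht.2 h0.le) (Real.rpow_nonneg (by linarith [ht.2]) _)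
    (Real.rpow_le_one (by linarith [ht.2]) (by linarith [ht.1]) (by linarith))

lemma auxL_pos {p t : ℝ} (ht : t ∈ Set.Ioo (0:ℝ) 1) : 0 < auxL p t :=
  mul_pos (Real.rpow_pos_of_pos ht.1 _) (Real.rpow_pos_of_pos (by linarith [ht.2]) _)

lemma auxL_lt {p t : ℝ} (h0 : 0 < p) (h1 : p < 1) (ht : t ∈ Set.Icc (0:ℝ) 1) (hne : t ≠ p) :
    auxL p t < auxL p p := by
  have hpp : 0 < auxL p p := auxL_pos ⟨h0, h1⟩
  rcases eq_or_lt_of_le ht.1 with h | h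
  · rw [← h] at *
    simpa [auxL, Real.zero_rpow h0.ne'] using hpp
  rcases eq_or_lt_of_le ht.2 with h' | h'
  · have : (1 - p) ≠ 0 := by linarith
    rw [h']
    simpa [auxL, Real.zero_rpow this] using hpp
  have q1 : 0 < 1 - p := by linarith
  have t1 : 0 < 1 - t := by linarith
  rw [← Real.log_lt_log_iff (auxL_pos ⟨h, h'⟩) hpp]
  unfold auxL
  rw [Real.log_mul (by positivity) (by positivity), Real.log_mul (by positivity) (by positivity),
    Real.log_rpow h, Real.log_rpow t1, Real.log_rpow h0, Real.log_rpow q1]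
  have l1 : Real.log (t / p) < t / p - 1 :=
    Real.log_lt_sub_one_of_pos (by positivity) (by rw [Ne, div_eq_one_iff_eq h0.ne']; exact hne)
  have l2 : Real.log ((1 - t) / (1 - p)) ≤ (1 - t) / (1 - p) - 1 :=
    Real.log_le_sub_one_of_pos (by positivity)
  rw [Real.log_div h.ne' h0.ne'] at l1
  rw [Real.log_div t1.ne' q1.ne'] at l2
  have m1 := mul_lt_mul_of_pos_left l1 h0
  have m2 := mul_le_mul_of_nonneg_left l2 q1.le
  have k1 : p * (t / p - 1) = t - p := by field_simp
  have k2 : (1 - p) * ((1 - t) / (1 - p) - 1) = p - t := by field_simp; ring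
  rw [k1] at m1
  rw [k2] at m2
  linarith

lemma auxL_le {p t : ℝ} (h0 : 0 < p) (h1 : p < 1) (ht : t ∈ Set.Icc (0:ℝ) 1) :
    auxL p t ≤ auxL p p := by
  by_cases h : t = p
  · rw [h]
  · exact (auxL_lt h0 h1 ht h).le

/-- one-dimensional prior weight -/
noncomputable def auxW (a b t : ℝ) : ℝ := t ^ (a - 1) * (1 - t) ^ (b - 1)

lemma auxW_int {a b : ℝ} (ha : 0 < a) (hb : 0 < b) :
    IntegrableOn (auxW a b) (Set.Ioo 0 1) := by
  have h := Complex.betaIntegral_convergent (u := a) (v := b) (by simpa) (by simpa)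
  rw [intervalIntegrable_iff_integrableOn_Ioo_of_le zero_le_one] at h
  refine IntegrableOn.congr_fun (Integrable.norm h) ?_ measurableSet_Ioo
  intro t ht
  have t1 : 0 < 1 - t := by linarith [ht.2]
  simp only [auxW, norm_mul]
  congr 1
  · rw [Complex.norm_cpow_eq_rpow_re_of_pos ht.1]; simp
  · have : (1 - (t:ℂ)) = ((1 - t : ℝ) : ℂ) := by push_cast; rfl
    rw [this, Complex.norm_cpow_eq_rpow_re_of_pos t1]; simp

lemma auxW_pos {a b t : ℝ} (ht : t ∈ Set.Ioo (0:ℝ) 1) : 0 < auxW a b t :=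
  mul_pos (Real.rpow_pos_of_pos ht.1 _) (Real.rpow_pos_of_pos (by linarith [ht.2]) _)

lemma auxW_shift {a b p t : ℝ} (n : ℕ) (ht : t ∈ Set.Ioo (0:ℝ) 1) :
    t ^ (a + n * p - 1) * (1 - t) ^ (b + n * (1 - p) - 1) = auxL p t ^ n * auxW a b t := by
  have t1 : 0 < 1 - t := by linarith [ht.2]
  unfold auxL auxW
  rw [mul_pow, ← Real.rpow_mul_natCast ht.1.le, ← Real.rpow_mul_natCast t1.le,
    show a + n * p - 1 = p * n + (a - 1) by ring,
    show b + n * (1 - p) - 1 = (1 - p) * n + (b - 1) by ring,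
    Real.rpow_add ht.1, Real.rpow_add t1]
  ring

lemma auxB {a b p : ℝ} (n : ℕ) :
    betaFn (a + n * p) (b + n * (1 - p)) = ∫ t in Set.Ioo (0:ℝ) 1, auxL p t ^ n * auxW a b t := by
  unfold betaFn
  rw [intervalIntegral.integral_of_le zero_le_one, integral_Ioc_eq_integral_Ioo]
  exact setIntegral_congr_fun measurableSet_Ioo (fun t ht => auxW_shift n ht)

lemma aux_main (a₁ b₁ a₀ b₀ : ℝ)
    (ha₁ : 0 < a₁) (hb₁ : 0 < b₁) (ha₀ : 0 < a₀) (hb₀ : 0 < b₀)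
    (p q θs : ℝ) (hp0 : 0 < p) (hp1 : p < 1) (hq0 : 0 < q) (hq1 : q < 1) (hθ : θs < p - q) :
    ∃ G : ℕ → ℝ, (∀ n : ℕ, G n =
      ∫ x in {x : ℝ × ℝ | x.1 ∈ Set.Ioo (0:ℝ) 1 ∧ x.2 ∈ Set.Ioo (0:ℝ) 1 ∧ x.1 - x.2 ≤ θs},
          betaPDF x.1 (a₁ + (n : ℝ) * p) (b₁ + (n : ℝ) * (1 - p)) *
            betaPDF x.2 (a₀ + (n : ℝ) * q) (b₀ + (n : ℝ) * (1 - q))) ∧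
     ∃ N : ℕ, ∀ n : ℕ, N ≤ n → G (n+1) ≤ G n := by
  refine ⟨_, fun _ => rfl, ?_⟩
  set S : Set (ℝ × ℝ) := Set.Ioo (0:ℝ) 1 ×ˢ Set.Ioo (0:ℝ) 1 with hS
  have hSm : MeasurableSet S := measurableSet_Ioo.prod measurableSet_Ioo
  have hSo : IsOpen S := isOpen_Ioo.prod isOpen_Ioo
  set A : Set (ℝ × ℝ) := {x | x.1 - x.2 ≤ θs} with hAdef
  have hAc : IsClosed A := isClosed_le (continuous_fst.sub continuous_snd) continuous_const
  have hset : {x : ℝ × ℝ | x.1 ∈ Set.Ioo (0:ℝ) 1 ∧ x.2 ∈ Set.Ioo (0:ℝ) 1 ∧ x.1 - x.2 ≤ θs}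
      = A ∩ S := by
    ext x
    simp only [hAdef, hS, Set.mem_inter_iff, Set.mem_ofPred_eq, Set.mem_prod]
    tauto
  set w : ℝ × ℝ → ℝ := fun x => auxW a₁ b₁ x.1 * auxW a₀ b₀ x.2 with hwdef
  set h : ℝ × ℝ → ℝ := fun x => auxL p x.1 * auxL q x.2 with hhdef
  have hcont : Continuous h :=
    ((auxL_cont hp0 hp1).comp continuous_fst).mul ((auxL_cont hq0 hq1).comp continuous_snd)
  have hvol : (volume : Measure (ℝ × ℝ)).restrict S =
      (volume.restrict (Set.Ioo (0:ℝ) 1)).prod (volume.restrict (Set.Ioo (0:ℝ) 1)) := by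
    rw [Measure.prod_restrict]; rfl
  have hw : Integrable w (volume.restrict S) := by
    rw [hvol]
    exact (auxW_int ha₁ hb₁).mul_prod (auxW_int ha₀ hb₀)
  have hsub : ∀ x ∈ S, x.1 ∈ Set.Icc (0:ℝ) 1 ∧ x.2 ∈ Set.Icc (0:ℝ) 1 := fun x hx =>
    ⟨Set.Ioo_subset_Icc_self hx.1, Set.Ioo_subset_Icc_self hx.2⟩
  have hmax : 0 < h (p, q) := mul_pos (auxL_pos ⟨hp0, hp1⟩) (auxL_pos ⟨hq0, hq1⟩)
  obtain ⟨c, hc0, hcM, hc⟩ : ∃ c, 0 ≤ c ∧ c < h (p, q) ∧ ∀ x ∈ S, x ∈ A → h x ≤ c := by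
    set K : Set (ℝ × ℝ) := (Set.Icc (0:ℝ) 1 ×ˢ Set.Icc (0:ℝ) 1) ∩ A with hK
    have hKc : IsCompact K := (isCompact_Icc.prod isCompact_Icc).inter_right hAc
    rcases K.eq_empty_or_nonempty with hE | hE
    · refine ⟨0, le_rfl, hmax, fun x hx hxA => ?_⟩
      have : x ∈ K := ⟨⟨(hsub x hx).1, (hsub x hx).2⟩, hxA⟩
      rw [hE] at this
      exact this.elim
    · obtain ⟨z, hz, hzm⟩ := hKc.exists_isMaxOn hE hcont.continuousOn
      refine ⟨h z, mul_nonneg (auxL_nonneg hz.1.1) (auxL_nonneg hz.1.2), ?_,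
        fun x hx hxA => hzm ⟨⟨(hsub x hx).1, (hsub x hx).2⟩, hxA⟩⟩
      have hzA : z.1 - z.2 ≤ θs := hz.2
      by_cases hz1 : z.1 = p
      · have hz2 : z.2 ≠ q := by
          intro h'
          rw [hz1, h'] at hzA
          linarith
        exact mul_lt_mul' (auxL_le hp0 hp1 hz.1.1) (auxL_lt hq0 hq1 hz.1.2 hz2)
          (auxL_nonneg hz.1.2) (auxL_pos ⟨hp0, hp1⟩)
      · exact lt_of_le_of_lt
            (mul_le_mul_of_nonneg_left (auxL_le hq0 hq1 hz.1.2) (auxL_nonneg hz.1.1))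
            (mul_lt_mul_of_pos_right (auxL_lt hp0 hp1 hz.1.1 hz1) (auxL_pos ⟨hq0, hq1⟩))
  obtain ⟨r, hcr, hrM⟩ := exists_between hcM
  have hwpos : ∀ x ∈ S, 0 < w x := fun x hx => mul_pos (auxW_pos hx.1) (auxW_pos hx.2)
  have hpos : 0 < ∫ x in {x | r ≤ h x}, w x ∂(volume.restrict S) := by
    have hRm : MeasurableSet {x | r ≤ h x} := measurableSet_le measurable_const hcont.measurable
    rw [Measure.restrict_restrict hRm]
    rw [setIntegral_pos_iff_support_of_nonneg_ae]
    · have ho : IsOpen ({x | r < h x} ∩ S) := (isOpen_lt continuous_const hcont).inter hSo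
      refine lt_of_lt_of_le (ho.measure_pos volume ⟨(p, q), hrM, ⟨hp0, hp1⟩, ⟨hq0, hq1⟩⟩)
        (measure_mono ?_)
      rintro x ⟨hx1, hx2⟩
      have hx3 : r < h x := hx1
      have hx4 : x ∈ {x | r ≤ h x} := by simpa using hx3.le
      exact ⟨(hwpos x hx2).ne', hx4, hx2⟩
    · refine (ae_restrict_iff' (hRm.inter hSm)).2 (Filter.Eventually.of_forall ?_)
      rintro x ⟨_, hx⟩
      exact (hwpos x hx).le
    · exact IntegrableOn.mono_set hw Set.inter_subset_right
  have aeS : ∀ P : ℝ × ℝ → Prop, (∀ x ∈ S, P x) → ∀ᵐ x ∂(volume.restrict S), P x :=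
    fun P hP => (ae_restrict_iff' hSm).2 (Filter.Eventually.of_forall hP)
  obtain ⟨hZ, N, hN⟩ := aux_key (volume.restrict S) w h A hAc.measurableSet hw
    (aeS _ fun x hx => (hwpos x hx).le) hcont.measurable
    (aeS _ fun x hx => mul_nonneg (auxL_nonneg (hsub x hx).1) (auxL_nonneg (hsub x hx).2))
    (aeS _ fun x hx => mul_le_one₀ (auxL_le_one hp0 hp1 (hsub x hx).1)
      (auxL_nonneg (hsub x hx).2) (auxL_le_one hq0 hq1 (hsub x hx).2))
    c r hc0 hcr (aeS _ hc) hpos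
  have hG : ∀ n : ℕ, (∫ x in A ∩ S,
          betaPDF x.1 (a₁ + (n : ℝ) * p) (b₁ + (n : ℝ) * (1 - p)) *
            betaPDF x.2 (a₀ + (n : ℝ) * q) (b₀ + (n : ℝ) * (1 - q))) =
      (∫ x in A, h x ^ n * w x ∂(volume.restrict S)) /
        (∫ x, h x ^ n * w x ∂(volume.restrict S)) := by
    intro n
    have hZn : (∫ x, h x ^ n * w x ∂(volume.restrict S)) =
        betaFn (a₁ + (n : ℝ) * p) (b₁ + (n : ℝ) * (1 - p)) *
        betaFn (a₀ + (n : ℝ) * q) (b₀ + (n : ℝ) * (1 - q)) := by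
      rw [auxB, auxB, hvol, ← integral_prod_mul]
      congr 1
      ext x
      simp only [hhdef, hwdef]
      ring
    rw [hZn, Measure.restrict_restrict hAc.measurableSet, ← integral_div]
    refine setIntegral_congr_fun (hAc.measurableSet.inter hSm) ?_
    rintro x ⟨_, hx⟩
    simp only [betaPDF]
    rw [auxW_shift n hx.1, auxW_shift n hx.2, div_mul_div_comm]
    congr 1
    simp only [hhdef, hwdef]
    ring
  refine ⟨N, fun n hn => ?_⟩
  simp only [hset]
  rw [hG, hG, div_le_div_iff₀ (hZ _) (hZ _)]
  exact hN n hn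

/-- (Proposition 2) For fixed evidence `e ∈ (0,1)`, threshold `θ* < e` and control
rate `ȳ₀ ∈ (0, 1-e)`, the double integral `G(n)` of the product of the posterior
Beta densities over `{θ₁ - θ₀ ≤ θ*}` is eventually nonincreasing in `n`. -/
theorem twoArm_binary_eventually_nonincreasing (a₁ b₁ a₀ b₀ : ℝ)
    (ha₁ : 0 < a₁) (hb₁ : 0 < b₁) (ha₀ : 0 < a₀) (hb₀ : 0 < b₀)
    (e : ℝ) (he0 : 0 < e) (he1 : e < 1) (θs : ℝ) (hθ : θs < e)
    (y₀ : ℝ) (hy₀ : 0 < y₀) (hy₁ : y₀ < 1 - e) :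
    ∃ N : ℕ, ∀ n : ℕ, N ≤ n →
      (∫ p in {p : ℝ × ℝ | p.1 ∈ Set.Ioo (0:ℝ) 1 ∧ p.2 ∈ Set.Ioo (0:ℝ) 1 ∧ p.1 - p.2 ≤ θs},
          betaPDF p.1 (a₁ + (n : ℝ) * (y₀ + e)) (b₁ + (n : ℝ) * (1 - y₀ - e)) *
            betaPDF p.2 (a₀ + (n : ℝ) * y₀) (b₀ + (n : ℝ) * (1 - y₀))) -
        (∫ p in {p : ℝ × ℝ | p.1 ∈ Set.Ioo (0:ℝ) 1 ∧ p.2 ∈ Set.Ioo (0:ℝ) 1 ∧ p.1 - p.2 ≤ θs},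
          betaPDF p.1 (a₁ + ((n : ℝ) + 1) * (y₀ + e)) (b₁ + ((n : ℝ) + 1) * (1 - y₀ - e)) *
            betaPDF p.2 (a₀ + ((n : ℝ) + 1) * y₀) (b₀ + ((n : ℝ) + 1) * (1 - y₀))) ≥ 0 := by

  obtain ⟨G, hG, N, hN⟩ := aux_main a₁ b₁ a₀ b₀ ha₁ hb₁ ha₀ hb₀ (y₀ + e) y₀ θs
    (by linarith) (by linarith) hy₀ (by linarith) (by linarith)
  refine ⟨N, fun n hn => ?_⟩
  have h := hN n hn
  rw [hG, hG] at h
  push_cast at h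
  rw [← sub_sub] at h
  linarith
end

section
/- (Proposition 3) Let a, b > 0, let e' > 0, and let θ' satisfy 0 < θ' < e'. Then there exists a natural number N such that for all n ≥ N, F_Gamma(θ'; a+ne', b+n) - F_Gamma(θ'; a+(n+1)e', b+n+1) ≥ 0; that is, the sequence n ↦ F_Gamma(θ'; a+ne', b+n) is eventually nonincreasing. -/
open Real MeasureTheory

/-- The Gamma CDF with shape `α > 0` and rate `l > 0`:
`F_Gamma(x; α, l) = (l^α / Γ(α)) ∫₀ˣ t^(α-1) e^(-l t) dt`. -/
noncomputable def gammaCDF (x α l : ℝ) : ℝ :=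
  (l ^ α / Real.Gamma α) * ∫ t in (0:ℝ)..x, t ^ (α - 1) * Real.exp (-(l * t))

lemma aux_lim (p q r s : ℝ) (hs : s ≠ 0) :
    Filter.Tendsto (fun n : ℕ => (p + (n:ℝ) * q) / (r + (n:ℝ) * s)) Filter.atTop (nhds (q / s)) := by
  have h1 : Filter.Tendsto (fun n : ℕ => (p / (n:ℝ) + q) / (r / (n:ℝ) + s)) Filter.atTop
      (nhds ((0 + q) / (0 + s))) :=
    ((tendsto_const_div_atTop_nhds_zero_nat p).add_const q).div
      ((tendsto_const_div_atTop_nhds_zero_nat r).add_const s) (by simpa using hs)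
  simp only [zero_add] at h1
  refine h1.congr' ?_
  filter_upwards [Filter.eventually_gt_atTop 0] with n hn
  have hn' : (n:ℝ) ≠ 0 := by positivity
  have e1 : p / (n:ℝ) + q = (p + n * q) / n := by field_simp
  have e2 : r / (n:ℝ) + s = (r + n * s) / n := by field_simp
  rw [e1, e2, div_div_div_cancel_right₀ hn']

lemma aux_gamma (α e : ℝ) (hα : 1 < α) (he : 0 < e) :
    (α - 1) ^ e * Real.Gamma α ≤ Real.Gamma (α + e) := by
  have h := Real.convexOn_log_Gamma.slope_mono_adjacent (x := α - 1) (y := α) (z := α + e)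
    (by simp; linarith) (by simp; linarith) (by linarith) (by linarith)
  have hG0 : 0 < Real.Gamma (α - 1) := Real.Gamma_pos_of_pos (by linarith)
  have hG1 : 0 < Real.Gamma α := Real.Gamma_pos_of_pos (by linarith)
  have hG2 : 0 < Real.Gamma (α + e) := Real.Gamma_pos_of_pos (by linarith)
  have hrec : Real.Gamma α = (α - 1) * Real.Gamma (α - 1) := by
    have := Real.Gamma_add_one (s := α - 1) (by linarith)
    simpa using this
  have hl : Real.log (Real.Gamma α) = Real.log (α - 1) + Real.log (Real.Gamma (α - 1)) := by
    rw [← Real.log_mul (by linarith) hG0.ne', ← hrec]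
  simp only [Function.comp] at h
  rw [show α - (α - 1) = 1 by ring, show α + e - α = e by ring, div_one, le_div_iff₀ he] at h
  have hp : 0 < (α - 1) ^ e := Real.rpow_pos_of_pos (by linarith) _
  rw [← Real.log_le_log_iff (by positivity) hG2, Real.log_mul hp.ne' hG1.ne',
    Real.log_rpow (by linarith)]
  rw [hl] at h ⊢
  nlinarith

lemma aux_mode (t θ e : ℝ) (ht : 0 < t) (htθ : t ≤ θ) (hθ : θ < e) :
    t ^ e * Real.exp (-t) ≤ θ ^ e * Real.exp (-θ) := by
  have hθ0 : 0 < θ := by linarith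
  rw [Real.rpow_def_of_pos ht, Real.rpow_def_of_pos hθ0, ← Real.exp_add, ← Real.exp_add,
    Real.exp_le_exp]
  have h := Real.log_le_sub_one_of_pos (div_pos ht hθ0)
  rw [Real.log_div ht.ne' hθ0.ne'] at h
  have h2 : (t / θ - 1) * e ≤ t - θ := by
    have : (t / θ - 1) * e = (t - θ) * (e / θ) := by field_simp
    rw [this]
    have : 1 ≤ e / θ := by rw [le_div_iff₀ hθ0]; linarith
    nlinarith
  nlinarith

lemma aux_int_s13 (x p c : ℝ) (hp : 0 < p) :
    IntervalIntegrable (fun t : ℝ => t ^ (p - 1) * Real.exp (-(c * t))) volume 0 x :=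
  (intervalIntegral.intervalIntegrable_rpow' (by linarith)).mul_continuousOn
    (by fun_prop)

lemma aux_step (α l e θ : ℝ) (hα : 1 < α) (hl : 0 < l) (hθ0 : 0 < θ) (hθ : θ < e)
    (hB : Real.exp (α / l) * ((l + 1) / (α - 1)) ^ e * (θ ^ e * Real.exp (-θ)) ≤ 1) :
    gammaCDF θ (α + e) (l + 1) ≤ gammaCDF θ α l := by
  have he : 0 < e := hθ0.trans hθ
  have hG1 : 0 < Real.Gamma α := Real.Gamma_pos_of_pos (by linarith)
  have hG2 : 0 < Real.Gamma (α + e) := Real.Gamma_pos_of_pos (by linarith)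
  have hg := aux_gamma α e hα he
  have hp : 0 < (α - 1) ^ e := Real.rpow_pos_of_pos (by linarith) _
  have hla : 0 < l ^ α := Real.rpow_pos_of_pos hl _
  have hle : 0 < (l + 1) ^ e := Real.rpow_pos_of_pos (by linarith) _
  set M := θ ^ e * Real.exp (-θ) with hM
  have hM0 : 0 < M := mul_pos (Real.rpow_pos_of_pos hθ0 _) (Real.exp_pos _)
  have hI : (∫ t in (0:ℝ)..θ, t ^ (α + e - 1) * Real.exp (-((l + 1) * t))) ≤
      M * ∫ t in (0:ℝ)..θ, t ^ (α - 1) * Real.exp (-(l * t)) := by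
    rw [← intervalIntegral.integral_const_mul]
    refine intervalIntegral.integral_mono_on_of_le_Ioo hθ0.le (aux_int_s13 _ _ _ (by linarith))
      ((aux_int_s13 _ _ _ (by linarith)).const_mul _) ?_
    intro t ht
    have h := aux_mode t θ e ht.1 ht.2.le hθ
    have e1 : t ^ (α + e - 1) * Real.exp (-((l + 1) * t)) =
        (t ^ e * Real.exp (-t)) * (t ^ (α - 1) * Real.exp (-(l * t))) := by
      rw [show α + e - 1 = e + (α - 1) by ring, Real.rpow_add ht.1,
        show -((l + 1) * t) = -t + -(l * t) by ring, Real.exp_add]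
      ring
    rw [e1]
    exact mul_le_mul_of_nonneg_right h
      (mul_nonneg (Real.rpow_nonneg ht.1.le _) (Real.exp_pos _).le)
  have hI0 : 0 ≤ ∫ t in (0:ℝ)..θ, t ^ (α - 1) * Real.exp (-(l * t)) :=
    intervalIntegral.integral_nonneg hθ0.le fun t ht =>
      mul_nonneg (Real.rpow_nonneg ht.1 _) (Real.exp_pos _).le
  have hpow : (l + 1) ^ α ≤ l ^ α * Real.exp (α / l) := by
    have h1 : l + 1 ≤ l * Real.exp (1 / l) := by
      have := Real.add_one_le_exp (1 / l)
      calc l + 1 = l * (1 / l + 1) := by field_simp; ring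
        _ ≤ _ := mul_le_mul_of_nonneg_left this hl.le
    calc (l + 1) ^ α ≤ (l * Real.exp (1 / l)) ^ α :=
          Real.rpow_le_rpow (by linarith) h1 (by linarith)
      _ = _ := by
          rw [Real.mul_rpow hl.le (Real.exp_pos _).le, ← Real.exp_mul]
          congr 2; ring
  have hC : (l + 1) ^ (α + e) / Real.Gamma (α + e) * M ≤ l ^ α / Real.Gamma α := by
    rw [Real.div_rpow (by linarith) (by linarith)] at hB
    calc (l + 1) ^ (α + e) / Real.Gamma (α + e) * M
        ≤ (l ^ α * Real.exp (α / l) * (l + 1) ^ e) / ((α - 1) ^ e * Real.Gamma α) * M := by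
          rw [Real.rpow_add (by linarith)]
          gcongr
      _ = (l ^ α / Real.Gamma α) *
          (Real.exp (α / l) * ((l + 1) ^ e / (α - 1) ^ e) * M) := by
          field_simp
      _ ≤ (l ^ α / Real.Gamma α) * 1 := mul_le_mul_of_nonneg_left hB (by positivity)
      _ = _ := mul_one _
  unfold gammaCDF
  have hc0 : 0 ≤ (l + 1) ^ (α + e) / Real.Gamma (α + e) :=
    div_nonneg (Real.rpow_nonneg (by linarith) _) hG2.le
  refine (mul_le_mul_of_nonneg_left hI hc0).trans ?_
  rw [← mul_assoc]
  exact mul_le_mul_of_nonneg_right hC hI0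

lemma aux_lt (e θ : ℝ) (hθ0 : 0 < θ) (hθ : θ < e) :
    Real.exp e * (1 / e) ^ e * (θ ^ e * Real.exp (-θ)) < 1 := by
  have he : 0 < e := hθ0.trans hθ
  have h := Real.log_lt_sub_one_of_pos (div_pos hθ0 he) (by
    rw [Ne, div_eq_one_iff_eq he.ne']; exact hθ.ne)
  rw [Real.log_div hθ0.ne' he.ne'] at h
  rw [Real.rpow_def_of_pos (by positivity), Real.rpow_def_of_pos hθ0, ← Real.exp_add,
    ← Real.exp_add, ← Real.exp_add, Real.exp_lt_one_iff, one_div, Real.log_inv]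
  have h2 := mul_lt_mul_of_pos_right h he
  have h3 : (θ / e - 1) * e = θ - e := by field_simp
  rw [h3] at h2
  linarith

/-- (Proposition 3) For `a, b > 0`, `e' > 0` and `0 < θ' < e'`, the sequence
`n ↦ F_Gamma(θ'; a+ne', b+n)` is eventually nonincreasing. -/
theorem gammaCDF_eventually_nonincreasing (a b e' θ' : ℝ) (ha : 0 < a) (hb : 0 < b)
    (he : 0 < e') (hθ0 : 0 < θ') (hθ : θ' < e') :
    ∃ N : ℕ, ∀ n : ℕ, N ≤ n →
      gammaCDF θ' (a + (n : ℝ) * e') (b + (n : ℝ)) -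
        gammaCDF θ' (a + ((n : ℝ) + 1) * e') (b + (n : ℝ) + 1) ≥ 0 := by
  have l1 := aux_lim a e' b 1 one_ne_zero
  have l2 := aux_lim (b + 1) 1 (a - 1) e' he.ne'
  rw [div_one] at l1
  have l3 := (((Real.continuous_exp.tendsto _).comp l1).mul
    (l2.rpow_const (p := e') (Or.inr he.le))).mul_const (θ' ^ e' * Real.exp (-θ'))
  have ev := l3.eventually_lt_const (aux_lt e' θ' hθ0 hθ)
  have ev2 : ∀ᶠ n : ℕ in Filter.atTop, 1 < a + (n:ℝ) * e' :=
    (Filter.tendsto_atTop_add_const_left _ a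
      (tendsto_natCast_atTop_atTop.atTop_mul_const he)).eventually_gt_atTop 1
  obtain ⟨N, hN⟩ := Filter.eventually_atTop.1 (ev.and ev2)
  refine ⟨N, fun n hn => ?_⟩
  obtain ⟨h1, h2⟩ := hN n hn
  have hs := aux_step (a + n * e') (b + n) e' θ' h2 (by positivity) hθ0 hθ (by
    refine le_of_eq_of_le ?_ h1.le
    simp only [Function.comp, mul_one]
    rw [show b + (n:ℝ) + 1 = b + 1 + n by ring, show a + (n:ℝ) * e' - 1 = a - 1 + n * e' by ring])
  rw [show a + ((n:ℝ) + 1) * e' = a + n * e' + e' by ring]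
  linarith
end

section
/- (Lemma, strict convexity for the Poisson/Gamma model) Let a, b, e' > 0. Then the function h(x) = log Γ(a + x·e') - (a + x·e')·log(b + x) is strictly convex on [0, ∞). -/
open Real

/-- tangent inequality for `u log (u / v)` -/
lemma aux_tangent {u v r : ℝ} (hu : 0 < u) (hv : 0 < v) (hr : 0 < r) :
    u * log r + u - v * r ≤ u * (log u - log v) := by
  have h := Real.log_le_sub_one_of_pos (x := r * v / u) (by positivity)
  rw [Real.log_div (by positivity) hu.ne', Real.log_mul hr.ne' hv.ne'] at h
  have h2 := mul_le_mul_of_nonneg_left h hu.le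
  have h3 : u * (r * v / u - 1) = r * v - u := by field_simp
  linarith

lemma aux_tangent_lt {u v r : ℝ} (hu : 0 < u) (hv : 0 < v) (hr : 0 < r) (hne : r * v ≠ u) :
    u * log r + u - v * r < u * (log u - log v) := by
  have h := Real.log_lt_sub_one_of_pos (x := r * v / u) (by positivity)
    (by rw [Ne, div_eq_one_iff_eq hu.ne']; exact hne)
  rw [Real.log_div (by positivity) hu.ne', Real.log_mul hr.ne' hv.ne'] at h
  have h2 := mul_lt_mul_of_pos_left h hu
  have h3 : u * (r * v / u - 1) = r * v - u := by field_simp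
  linarith

lemma aux_persp (a b e' : ℝ) (ha : 0 < a) (hb : 0 < b) (he : 0 < e') :
    ConvexOn ℝ (Set.Ici (0:ℝ)) (fun x : ℝ => (a + x * e') * (log (a + x * e') - log (b + x))) := by
  refine ⟨convex_Ici 0, fun x hx y hy s t hs ht hst => ?_⟩
  simp only [Set.mem_Ici, smul_eq_mul] at *
  have hz : 0 ≤ s * x + t * y := by positivity
  set z := s * x + t * y with hzd
  have hu : 0 < a + z * e' := by positivity
  have hv : 0 < b + z := by positivity
  have hr : 0 < (a + z * e') / (b + z) := by positivity
  have h1 := aux_tangent (u := a + x * e') (v := b + x) (by positivity) (by positivity) hr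
  have h2 := aux_tangent (u := a + y * e') (v := b + y) (by positivity) (by positivity) hr
  rw [← Real.log_div hu.ne' hv.ne']
  set r := (a + z * e') / (b + z) with hrd
  have h3 : (b + z) * r = a + z * e' := by rw [hrd]; field_simp
  have h1' := mul_le_mul_of_nonneg_left h1 hs
  have h2' := mul_le_mul_of_nonneg_left h2 ht
  have ht' : t = 1 - s := by linarith
  have key : (a + z * e') * log r = s * ((a + x * e') * log r + (a + x * e') - (b + x) * r) +
      t * ((a + y * e') * log r + (a + y * e') - (b + y) * r) := by
    have : (a + z * e') * log r = (a + z * e') * log r + (a + z * e') - (b + z) * r := by linarith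
    rw [this, hzd, ht']; ring
  linarith

lemma aux_phi :
    StrictConvexOn ℝ (Set.Ioi (0:ℝ)) (fun x : ℝ => (x + 1) * (log (x + 1) - log x)) := by
  refine ⟨convex_Ioi 0, fun x hx y hy hxy s t hs ht hst => ?_⟩
  simp only [Set.mem_Ioi, smul_eq_mul] at *
  have hz : 0 < s * x + t * y := by positivity
  have ht' : t = 1 - s := by linarith
  have hxz : s * x + t * y ≠ x := by
    intro h
    have : t * (y - x) = 0 := by rw [ht'] at h ⊢; linarith
    rcases mul_eq_zero.1 this with h | h
    · linarith
    · exact hxy (by linarith)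
  set z := s * x + t * y with hzd
  have hr : 0 < (z + 1) / z := by positivity
  have h1 := aux_tangent_lt (u := x + 1) (v := x) (by positivity) (by positivity) hr (by
    intro h
    field_simp at h
    apply hxz; linarith)
  have h2 := aux_tangent (u := y + 1) (v := y) (by positivity) (by positivity) hr
  rw [← Real.log_div (by positivity : z + 1 ≠ 0) hz.ne']
  set r := (z + 1) / z with hrd
  have h3 : z * r = z + 1 := by rw [hrd]; field_simp
  have h1' := mul_lt_mul_of_pos_left h1 hs
  have h2' := mul_le_mul_of_nonneg_left h2 ht.le
  have key : (z + 1) * log r = s * ((x + 1) * log r + (x + 1) - x * r) +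
      t * ((y + 1) * log r + (y + 1) - y * r) := by
    have : (z + 1) * log r = (z + 1) * log r + (z + 1) - z * r := by linarith
    rw [this, hzd, ht']; ring
  linarith

lemma aux_shift {f : ℝ → ℝ} (hf : ConvexOn ℝ (Set.Ioi (0:ℝ)) f) :
    ConvexOn ℝ (Set.Ioi (0:ℝ)) (fun x => f (x + 1)) := by
  refine ⟨convex_Ioi 0, fun x hx y hy s t hs ht hst => ?_⟩
  simp only [Set.mem_Ioi] at hx hy
  have h := hf.2 (x := x + 1) (y := y + 1) (by simp only [Set.mem_Ioi]; positivity)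
    (by simp only [Set.mem_Ioi]; positivity) hs ht hst
  have e : s • (x + 1) + t • (y + 1) = s • x + t • y + 1 := by
    simp only [smul_eq_mul]; linarith
  rw [e] at h
  exact h

lemma aux_logGamma {x : ℝ} (hx : 0 < x) : log (Gamma (x + 1)) = log x + log (Gamma x) := by
  rw [Real.Gamma_add_one hx.ne', Real.log_mul hx.ne' (Real.Gamma_pos_of_pos hx).ne']

lemma aux_K (n : ℕ) : ConvexOn ℝ (Set.Ioi (0:ℝ))
    (fun x : ℝ => log (Gamma x) - x * log x + (x + n) * log (x + n)) := by
  induction n with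
  | zero =>
    refine Real.convexOn_log_Gamma.congr fun x hx => ?_
    simp
  | succ n ih =>
    refine ((aux_shift ih).add aux_phi.convexOn).congr fun x hx => ?_
    simp only [Pi.add_apply, aux_logGamma hx]
    push_cast
    rw [show x + 1 + (n:ℝ) = x + (n + 1) by ring]
    ring

lemma aux_lim_s14 (x : ℝ) (hx : 0 < x) : Filter.Tendsto
    (fun n : ℕ => (x + n) * log (x + n) - (x + n) * log n) Filter.atTop (nhds x) := by
  have h1 : Filter.Tendsto (fun n : ℕ => (n:ℝ) * log (1 + x / n)) Filter.atTop (nhds x) :=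
    (Real.tendsto_mul_log_one_add_div_atTop x).comp tendsto_natCast_atTop_atTop
  have h2 : Filter.Tendsto (fun n : ℕ => x / (n:ℝ)) Filter.atTop (nhds 0) :=
    tendsto_const_div_atTop_nhds_zero_nat x
  have h3 : Filter.Tendsto (fun n : ℕ => (1 + x / (n:ℝ)) * ((n:ℝ) * log (1 + x / n)))
      Filter.atTop (nhds ((1 + 0) * x)) := (h2.const_add 1).mul h1
  rw [add_zero, one_mul] at h3
  refine h3.congr' ?_
  filter_upwards [Filter.eventually_gt_atTop 0] with n hn
  have hn' : (0:ℝ) < n := by exact_mod_cast hn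
  have : 1 + x / (n:ℝ) = (x + n) / n := by field_simp; ring
  rw [this, Real.log_div (by positivity) hn'.ne']
  field_simp

lemma aux_G : ConvexOn ℝ (Set.Ioi (0:ℝ)) (fun x : ℝ => log (Gamma x) - x * log x) := by
  refine ⟨convex_Ioi 0, fun x hx y hy s t hs ht hst => ?_⟩
  have hz : s • x + t • y ∈ Set.Ioi (0:ℝ) := convex_Ioi 0 hx hy hs ht hst
  have lx := aux_lim_s14 x hx
  have ly := aux_lim_s14 y hy
  have lz := aux_lim_s14 _ hz
  set z := s • x + t • y with hzd
  simp only [smul_eq_mul] at *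
  have L := ((lx.const_mul s).add (ly.const_mul t)).sub lz
  rw [← hzd, sub_self] at L
  suffices log (Gamma z) - z * log z - (s * (log (Gamma x) - x * log x)
      + t * (log (Gamma y) - y * log y)) ≤ 0 by linarith
  refine ge_of_tendsto' L fun n => ?_
  have h := (aux_K n).2 hx hy hs ht hst
  simp only [smul_eq_mul] at h
  rw [← hzd] at h
  have e : s * ((x + n) * log n) + t * ((y + n) * log n) = (z + n) * log n := by
    have ht' : t = 1 - s := by linarith
    rw [hzd, ht']; ring
  linarith

lemma aux_G_strict :
    StrictConvexOn ℝ (Set.Ioi (0:ℝ)) (fun x : ℝ => log (Gamma x) - x * log x) := by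
  refine ((aux_shift aux_G).add_strictConvexOn aux_phi).congr fun x hx => ?_
  simp only [Pi.add_apply, aux_logGamma hx]
  ring

/-- (Lemma, strict convexity for the Poisson/Gamma model) For `a, b, e' > 0`,
the function `h(x) = log Γ(a + x e') - (a + x e') log(b + x)` is strictly
convex on `[0, ∞)`. -/
theorem strictConvexOn_logGamma_sub (a b e' : ℝ) (ha : 0 < a) (hb : 0 < b)
    (he : 0 < e') :
    StrictConvexOn ℝ (Set.Ici (0:ℝ))
      (fun x : ℝ => Real.log (Real.Gamma (a + x * e')) - (a + x * e') * Real.log (b + x)) := by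
  refine ⟨convex_Ici 0, fun x hx y hy hxy s t hs ht hst => ?_⟩
  have h1 := (aux_persp a b e' ha hb he).2 hx hy hs.le ht.le hst
  simp only [Set.mem_Ici] at hx hy
  have h2 := aux_G_strict.2 (x := a + x * e') (y := a + y * e')
    (by simp only [Set.mem_Ioi]; positivity) (by simp only [Set.mem_Ioi]; positivity)
    (by intro h; exact hxy (mul_right_cancel₀ he.ne' (by linarith))) hs ht hst
  simp only [smul_eq_mul] at *
  have e : s * (a + x * e') + t * (a + y * e') = a + (s * x + t * y) * e' := by
    have ht' : t = 1 - s := by linarith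
    rw [ht']; ring
  rw [e] at h2
  linarith
end

section
/- For all a, b, e' > 0 and every natural number n, the strict inequality Γ(a+(n+2)e') · Γ(a+ne') · (b+n+1)^{2(a+(n+1)e')} > Γ(a+(n+1)e')² · (b+n)^{a+ne'} · (b+n+2)^{a+(n+2)e'} holds. Consequently, the ratio R_g(n) = Γ(a+(n+1)e')·(b+n)^{a+ne'} / (Γ(a+ne')·(b+n+1)^{a+(n+1)e'}) is strictly increasing in n ∈ ℕ. -/
open Real

open MeasureTheory Set in
lemma gr_aux (α x e : ℝ) (hα : 0 < α) (hx : 0 < x) (he : 0 < e) :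
    ((1 / (x + 1)) ^ (α + e) * Real.Gamma (α + e)) ^ 2 <
      ((1 / x) ^ α * Real.Gamma α) * ((1 / (x + 2)) ^ (α + 2 * e) * Real.Gamma (α + 2 * e)) := by
  have P : ∀ p r : ℝ, 0 < p → 0 < r → 0 < (1 / r) ^ p * Real.Gamma p := fun p r hp hr =>
    mul_pos (Real.rpow_pos_of_pos (by positivity) _) (Real.Gamma_pos_of_pos hp)
  have I : ∀ p r : ℝ, 0 < p → 0 < r →
      IntegrableOn (fun t : ℝ => t ^ (p - 1) * Real.exp (-(r * t))) (Ioi 0) := by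
    intro p r hp hr
    by_contra h
    have h1 := integral_undef h
    rw [Real.integral_rpow_mul_exp_neg_mul_Ioi hp hr] at h1
    exact (P p r hp hr).ne' h1
  have J0 := Real.integral_rpow_mul_exp_neg_mul_Ioi hα hx
  have J1 := Real.integral_rpow_mul_exp_neg_mul_Ioi (a := α + e) (r := x + 1)
    (by positivity) (by positivity)
  have J2 := Real.integral_rpow_mul_exp_neg_mul_Ioi (a := α + 2 * e) (r := x + 2)
    (by positivity) (by positivity)
  have I0 := I α x hα hx
  have I1 := I (α + e) (x + 1) (by positivity) (by positivity)
  have I2 := I (α + 2 * e) (x + 2) (by positivity) (by positivity)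
  have P0 := P α x hα hx
  have P1 := P (α + e) (x + 1) (by positivity) (by positivity)
  set F0 := (1 / x) ^ α * Real.Gamma α
  set F1 := (1 / (x + 1)) ^ (α + e) * Real.Gamma (α + e)
  set F2 := (1 / (x + 2)) ^ (α + 2 * e) * Real.Gamma (α + 2 * e)
  obtain ⟨l, hl⟩ : ∃ l, l = F1 / F0 := ⟨_, rfl⟩
  have hl0 : 0 < l := hl ▸ div_pos P1 P0
  have EQ : EqOn (fun t : ℝ => l ^ 2 * (t ^ (α - 1) * Real.exp (-(x * t)))
      - 2 * l * (t ^ (α + e - 1) * Real.exp (-((x + 1) * t)))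
      + t ^ (α + 2 * e - 1) * Real.exp (-((x + 2) * t)))
      (fun t => t ^ (α - 1) * Real.exp (-(x * t)) * (l - t ^ e * Real.exp (-t)) ^ 2) (Ioi 0) := by
    intro t ht
    have ht : 0 < t := ht
    have e1 : t ^ (α + e - 1) = t ^ (α - 1) * t ^ e := by
      rw [← Real.rpow_add ht]; ring_nf
    have e2 : t ^ (α + 2 * e - 1) = t ^ (α - 1) * t ^ e * t ^ e := by
      rw [← Real.rpow_add ht, ← Real.rpow_add ht]; ring_nf
    have e3 : Real.exp (-((x + 1) * t)) = Real.exp (-(x * t)) * Real.exp (-t) := by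
      rw [← Real.exp_add]; ring_nf
    have e4 : Real.exp (-((x + 2) * t)) = Real.exp (-(x * t)) * Real.exp (-t) * Real.exp (-t) := by
      rw [← Real.exp_add, ← Real.exp_add]; ring_nf
    simp only [e1, e2, e3, e4]
    ring
  have IA := (I0.const_mul (l ^ 2)).sub (I1.const_mul (2 * l))
  have IT := IA.add I2
  have hint : ∫ t in Ioi (0:ℝ), t ^ (α - 1) * Real.exp (-(x * t)) * (l - t ^ e * Real.exp (-t)) ^ 2
      = l ^ 2 * F0 - 2 * l * F1 + F2 := by
    rw [← setIntegral_congr_fun measurableSet_Ioi EQ]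
    refine (integral_add IA I2).trans ?_
    simp only [Pi.sub_apply]
    rw [integral_sub (I0.const_mul (l ^ 2)) (I1.const_mul (2 * l)),
      integral_const_mul, integral_const_mul, J0, J1, J2]
  have IT' : IntegrableOn
      (fun t : ℝ => t ^ (α - 1) * Real.exp (-(x * t)) * (l - t ^ e * Real.exp (-t)) ^ 2) (Ioi 0) :=
    IntegrableOn.congr_fun IT EQ measurableSet_Ioi
  have hpos : 0 < ∫ t in Ioi (0:ℝ),
      t ^ (α - 1) * Real.exp (-(x * t)) * (l - t ^ e * Real.exp (-t)) ^ 2 := by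
    rw [setIntegral_pos_iff_support_of_nonneg_ae _ IT']
    · have hc : 0 < l ^ (1 / e) := Real.rpow_pos_of_pos hl0 _
      have hv : 0 < volume (Ioo (0:ℝ) (l ^ (1 / e))) := by simpa using hc
      refine hv.trans_le (measure_mono ?_)
      rintro t ⟨h0, h1⟩
      refine ⟨?_, h0⟩
      have h2 : t ^ e < l := by
        have := Real.rpow_lt_rpow h0.le h1 he
        rwa [← Real.rpow_mul hl0.le, one_div_mul_cancel he.ne', Real.rpow_one] at this
      have h3 : Real.exp (-t) < 1 := by simpa using h0
      have h4 : 0 < t ^ e := Real.rpow_pos_of_pos h0 _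
      have h5 : 0 < l - t ^ e * Real.exp (-t) := by nlinarith
      have h6 : 0 < t ^ (α - 1) := Real.rpow_pos_of_pos h0 _
      simp only [Function.mem_support]
      positivity
    · refine (ae_restrict_iff' measurableSet_Ioi).2 (Filter.Eventually.of_forall fun t ht => ?_)
      have ht : 0 < t := ht
      simp only [Pi.zero_apply]
      positivity
  rw [hint] at hpos
  have : l * F0 = F1 := by rw [hl]; field_simp
  have h7 : 0 < (l ^ 2 * F0 - 2 * l * F1 + F2) * F0 := mul_pos hpos P0
  have h8 : (l ^ 2 * F0 - 2 * l * F1 + F2) * F0 = F0 * F2 - F1 ^ 2 := by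
    rw [← this]; ring
  linarith

lemma gr_aux2 (α x e : ℝ) (hα : 0 < α) (hx : 0 < x) (he : 0 < e) :
    Real.Gamma (α + e) ^ 2 * x ^ α * (x + 2) ^ (α + 2 * e) <
      Real.Gamma (α + 2 * e) * Real.Gamma α * ((x + 1) ^ (α + e)) ^ 2 := by
  have h := gr_aux α x e hα hx he
  rw [Real.div_rpow (by positivity) (by positivity), Real.div_rpow (by positivity) (by positivity),
    Real.div_rpow (by positivity) (by positivity)] at h
  simp only [Real.one_rpow] at h
  have h0 : 0 < x ^ α := by positivity
  have h1 : 0 < (x + 1) ^ (α + e) := by positivity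
  have h2 : 0 < (x + 2) ^ (α + 2 * e) := by positivity
  have := mul_lt_mul_of_pos_right h (mul_pos (mul_pos h0 h2) (pow_pos h1 2))
  field_simp at this
  rw [mul_comm e 2] at this
  linarith

/-- For all `a, b, e' > 0` and every `n : ℕ`, the strict inequality
`Γ(a+(n+2)e') Γ(a+ne') (b+n+1)^(2(a+(n+1)e')) >
 Γ(a+(n+1)e')² (b+n)^(a+ne') (b+n+2)^(a+(n+2)e')` holds; consequently the ratio
`R_g(n) = Γ(a+(n+1)e') (b+n)^(a+ne') / (Γ(a+ne') (b+n+1)^(a+(n+1)e'))`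
is strictly increasing in `n : ℕ`. -/
theorem gammaRatio_strictMono (a b e' : ℝ) (ha : 0 < a) (hb : 0 < b) (he : 0 < e') :
    (∀ n : ℕ,
      Real.Gamma (a + ((n : ℝ) + 2) * e') * Real.Gamma (a + (n : ℝ) * e') *
          (b + (n : ℝ) + 1) ^ (2 * (a + ((n : ℝ) + 1) * e')) >
        Real.Gamma (a + ((n : ℝ) + 1) * e') ^ 2 * (b + (n : ℝ)) ^ (a + (n : ℝ) * e') *
          (b + (n : ℝ) + 2) ^ (a + ((n : ℝ) + 2) * e')) ∧
    StrictMono (fun n : ℕ =>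
      Real.Gamma (a + ((n : ℝ) + 1) * e') * (b + (n : ℝ)) ^ (a + (n : ℝ) * e') /
        (Real.Gamma (a + (n : ℝ) * e') * (b + (n : ℝ) + 1) ^ (a + ((n : ℝ) + 1) * e'))) := by
  have key : ∀ n : ℕ, _ := fun n : ℕ =>
    gr_aux2 (a + (n : ℝ) * e') (b + (n : ℝ)) e' (by positivity) (by positivity) he
  have c1 : ∀ n : ℕ, a + (n : ℝ) * e' + e' = a + ((n : ℝ) + 1) * e' := fun n => by ring
  have c2 : ∀ n : ℕ, a + (n : ℝ) * e' + 2 * e' = a + ((n : ℝ) + 2) * e' := fun n => by ring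
  simp only [c1, c2] at key
  refine ⟨fun n => ?_, strictMono_nat_of_lt_succ fun n => ?_⟩
  · have := key n
    rw [mul_comm 2 (a + ((n : ℝ) + 1) * e'), Real.rpow_mul (by positivity), Real.rpow_two]
    exact this
  · have k := key n
    have d1 : b + ((n : ℝ) + 1) + 1 = b + n + 2 := by ring
    have d2 : (n : ℝ) + 1 + 1 = n + 2 := by ring
    have d3 : b + ((n : ℝ) + 1) = b + n + 1 := by ring
    push_cast
    rw [d1, d2, d3]
    have g0 : 0 < Real.Gamma (a + (n : ℝ) * e') := Real.Gamma_pos_of_pos (by positivity)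
    have g1 : 0 < Real.Gamma (a + ((n : ℝ) + 1) * e') := Real.Gamma_pos_of_pos (by positivity)
    rw [div_lt_div_iff₀ (by positivity) (by positivity)]
    linarith
end

section
/- For all a, b, e' > 0, the limit as n → ∞ (n ranging over the natural numbers) of Γ(a+(n+1)e')·(b+n)^{a+ne'} / (Γ(a+ne')·(b+n+1)^{a+(n+1)e'}) equals (e')^{e'} · exp(-e'). -/
open Real Filter

theorem gr_bounds (x s : ℝ) (hx : 1 < x) (hs : 0 < s) :
    (x - 1) ^ s ≤ Real.Gamma (x + s) / Real.Gamma x ∧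
      Real.Gamma (x + s) / Real.Gamma x ≤ (x + s) ^ s := by
  have h1 := Real.convexOn_log_Gamma.slope_mono_adjacent (x := x - 1) (y := x) (z := x + s)
    (by simp only [Set.mem_Ioi]; linarith) (by simp only [Set.mem_Ioi]; linarith) (by linarith) (by linarith)
  have h2 := Real.convexOn_log_Gamma.slope_mono_adjacent (x := x) (y := x + s) (z := x + s + 1)
    (by simp only [Set.mem_Ioi]; linarith) (by simp only [Set.mem_Ioi]; linarith) (by linarith) (by linarith)
  have g0 : 0 < Real.Gamma (x - 1) := Real.Gamma_pos_of_pos (by linarith)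
  have g1 : 0 < Real.Gamma x := Real.Gamma_pos_of_pos (by linarith)
  have g2 : 0 < Real.Gamma (x + s) := Real.Gamma_pos_of_pos (by linarith)
  have e1 : Real.log (Real.Gamma x) = Real.log (x - 1) + Real.log (Real.Gamma (x - 1)) := by
    have := Real.Gamma_add_one (s := x - 1) (by linarith)
    rw [sub_add_cancel] at this
    rw [this, Real.log_mul (by linarith) g0.ne']
  have e2 : Real.log (Real.Gamma (x + s + 1)) = Real.log (x + s) + Real.log (Real.Gamma (x + s)) := by
    rw [Real.Gamma_add_one (by linarith), Real.log_mul (by linarith) g2.ne']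
  simp only [Function.comp] at h1 h2
  rw [show x - (x - 1) = 1 by ring, show x + s - x = s by ring, div_one, le_div_iff₀ hs] at h1
  rw [show x + s + 1 - (x + s) = 1 by ring, show x + s - x = s by ring, div_one, div_le_iff₀ hs] at h2
  have el : Real.Gamma (x + s) / Real.Gamma x
      = Real.exp (Real.log (Real.Gamma (x + s)) - Real.log (Real.Gamma x)) := by
    rw [Real.exp_sub, Real.exp_log g2, Real.exp_log g1]
  rw [el, Real.rpow_def_of_pos (by linarith), Real.rpow_def_of_pos (by linarith)]
  constructor
  · apply Real.exp_le_exp.2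
    rw [e1] at h1 ⊢
    linarith
  · apply Real.exp_le_exp.2
    rw [e2] at h2
    linarith

theorem gr_lin (c d e' : ℝ) :
    Tendsto (fun n : ℕ => (c + (n : ℝ) * e') / (d + (n : ℝ))) atTop (nhds e') := by
  have hN : Tendsto (fun n : ℕ => (n : ℝ)) atTop atTop := tendsto_natCast_atTop_atTop
  have h0 : Tendsto (fun n : ℕ => e' + (c - d * e') / (d + (n : ℝ))) atTop (nhds (e' + 0)) :=
    tendsto_const_nhds.add (Tendsto.const_div_atTop (tendsto_atTop_add_const_left _ d hN) _)
  rw [add_zero] at h0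
  refine h0.congr' ?_
  filter_upwards [hN.eventually_gt_atTop (-d)] with n hn
  have : d + (n : ℝ) ≠ 0 := by linarith
  field_simp
  ring

/-- For all `a, b, e' > 0`, the ratio
`Γ(a+(n+1)e') (b+n)^(a+ne') / (Γ(a+ne') (b+n+1)^(a+(n+1)e'))`
tends to `(e')^(e') exp(-e')` as `n → ∞`. -/
theorem gammaRatio_tendsto (a b e' : ℝ) (ha : 0 < a) (hb : 0 < b) (he : 0 < e') :
    Tendsto (fun n : ℕ =>
        Real.Gamma (a + ((n : ℝ) + 1) * e') * (b + (n : ℝ)) ^ (a + (n : ℝ) * e') /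
          (Real.Gamma (a + (n : ℝ) * e') * (b + (n : ℝ) + 1) ^ (a + ((n : ℝ) + 1) * e')))
      atTop (nhds (e' ^ e' * Real.exp (-e'))) := by
  have hN : Tendsto (fun n : ℕ => (n : ℝ)) atTop atTop := tendsto_natCast_atTop_atTop
  have hX : Tendsto (fun n : ℕ => a + (n : ℝ) * e') atTop atTop :=
    tendsto_atTop_add_const_left _ a (hN.atTop_mul_const he)
  have hl (c : ℝ) : Tendsto (fun n : ℕ => ((c + (n : ℝ) * e') / (b + 1 + (n : ℝ))) ^ e') atTop
      (nhds (e' ^ e')) := (gr_lin c (b + 1) e').rpow_const (Or.inl he.ne')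
  have hA : Tendsto (fun n : ℕ => Real.Gamma (a + (n : ℝ) * e' + e') / Real.Gamma (a + (n : ℝ) * e')
      / (b + 1 + (n : ℝ)) ^ e') atTop (nhds (e' ^ e')) := by
    refine tendsto_of_tendsto_of_tendsto_of_le_of_le' (hl (a - 1)) (hl (a + e')) ?_ ?_
    all_goals
      filter_upwards [hX.eventually_gt_atTop 1] with n hn
      obtain ⟨h1, h2⟩ := gr_bounds _ e' hn he
      have hn0 : (0 : ℝ) ≤ n := n.cast_nonneg
      have hp : (0 : ℝ) < b + 1 + n := by linarith
      rw [Real.div_rpow (by linarith) hp.le]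
      gcongr
    · refine le_trans (le_of_eq ?_) h1
      congr 1; ring
    · refine le_trans h2 (le_of_eq ?_)
      congr 1; ring
  have hB : Tendsto (fun n : ℕ => (1 + -1 / (b + 1 + (n : ℝ))) ^ (a + (n : ℝ) * e')) atTop
      (nhds (Real.exp (-e'))) := by
    have hx : Tendsto (fun x : ℝ => x * ((-e') / (x + ((b + 1) * e' - a)))) atTop (nhds (-e')) := by
      have h0 : Tendsto (fun x : ℝ => -e' + e' * ((b + 1) * e' - a) / (x + ((b + 1) * e' - a))) atTop
          (nhds (-e' + 0)) :=
        tendsto_const_nhds.add (Tendsto.const_div_atTop (tendsto_atTop_add_const_right _ _ tendsto_id) _)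
      rw [add_zero] at h0
      refine h0.congr' ?_
      filter_upwards [eventually_gt_atTop (-((b + 1) * e' - a))] with x hx
      have : x + ((b + 1) * e' - a) ≠ 0 := by linarith
      generalize (b + 1) * e' - a = k at *
      field_simp
      ring
    refine ((Real.tendsto_one_add_rpow_exp_of_tendsto hx).comp hX).congr fun n => ?_
    have hp : (b + 1 + (n : ℝ)) ≠ 0 := by positivity
    simp only [Function.comp]
    congr 2
    rw [show a + (n : ℝ) * e' + ((b + 1) * e' - a) = (b + 1 + n) * e' by ring]
    field_simp
  refine (hA.mul hB).congr fun n => ?_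
  have hp : 0 < b + (n : ℝ) := by positivity
  have hp1 : 0 < b + 1 + (n : ℝ) := by positivity
  have g1 : 0 < Real.Gamma (a + (n : ℝ) * e') := Real.Gamma_pos_of_pos (by positivity)
  rw [show 1 + -1 / (b + 1 + (n : ℝ)) = (b + n) / (b + 1 + n) by field_simp; ring,
    Real.div_rpow hp.le hp1.le, show a + ((n : ℝ) + 1) * e' = a + n * e' + e' by ring,
    show b + (n : ℝ) + 1 = b + 1 + n by ring, Real.rpow_add hp1 (a + (n : ℝ) * e') e']
  generalize a + (n : ℝ) * e' = x at *
  have p1 := Real.rpow_pos_of_pos hp1 x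
  have p2 := Real.rpow_pos_of_pos hp1 e'
  generalize (b + 1 + (n : ℝ)) ^ x = u at *
  generalize (b + 1 + (n : ℝ)) ^ e' = v at *
  field_simp
end

section
/- (Theorem 4) Let a₁, b₁, a₀, b₀ > 0, let ȳ₀ > 0 and e > 0 be fixed, and let θ* < e be real. Define H(n) = ∬_{{(θ₁,θ₀) ∈ (0,∞)² : θ₁ - θ₀ ≤ θ*}} f_Gamma(θ₁; a₁+n(ȳ₀+e), b₁+n) · f_Gamma(θ₀; a₀+nȳ₀, b₀+n) dθ₁ dθ₀. Then there exists a natural number N such that for all n ≥ N, H(n) - H(n+1) ≥ 0; that is, the quantity 1 - H(n) increases monotonically with n for all n ≥ N. -/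
open Real MeasureTheory

open Set Filter Topology in
theorem gamma_ratio_s17 (α y : ℝ) (hα : 1 < α) (hy : 0 < y) :
    Real.Gamma α * (α - 1) ^ y ≤ Real.Gamma (α + y) := by
  have h := Real.convexOn_log_Gamma.slope_mono_adjacent (x := α - 1) (y := α) (z := α + y)
    (by simp; linarith) (by simp; linarith) (by linarith) (by linarith)
  have hg0 := Real.Gamma_pos_of_pos (show 0 < α - 1 by linarith)
  have hg1 := Real.Gamma_pos_of_pos (show 0 < α by linarith)
  have hg2 := Real.Gamma_pos_of_pos (show 0 < α + y by linarith)
  have h1 : Real.Gamma α = (α - 1) * Real.Gamma (α - 1) := by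
    have := Real.Gamma_add_one (s := α - 1) (by linarith)
    rwa [sub_add_cancel] at this
  have hl : Real.log (Real.Gamma α) = Real.log (α - 1) + Real.log (Real.Gamma (α - 1)) := by
    rw [h1, Real.log_mul (by linarith) hg0.ne']
  simp only [Function.comp] at h
  rw [show α - (α - 1) = 1 by ring, show α + y - α = y by ring, div_one, le_div_iff₀ hy] at h
  rw [← Real.log_le_log_iff (by have : 0 < α - 1 := by linarith
                                positivity) hg2,
    Real.log_mul hg1.ne' (by have : 0 < α - 1 := by linarith
                             positivity), Real.log_rpow (by linarith)]
  rw [hl] at h ⊢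
  nlinarith

theorem gammaPDF_nonneg' (t α l : ℝ) (ht : 0 < t) (hα : 0 < α) (hl : 0 < l) :
    0 ≤ gammaPDF t α l := by
  have := Real.Gamma_pos_of_pos hα
  unfold gammaPDF
  positivity

theorem gammaPDF_step (α y B t : ℝ) (hα : 1 < α) (hy : 0 < y) (hB : 0 < B) (ht : 0 < t) :
    gammaPDF t (α + y) (B + 1) ≤ gammaPDF t α B *
      Real.exp (y * (Real.log (B + 1) - Real.log (α - 1)) + α / B + y * Real.log t - t) := by
  have hg1 := Real.Gamma_pos_of_pos (show 0 < α by linarith)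
  have hα1 : 0 < α - 1 := by linarith
  have hr := gamma_ratio_s17 α y hα hy
  have hp : 0 < (α - 1) ^ y := by positivity
  have e1 : Real.exp (y * (Real.log (B + 1) - Real.log (α - 1)) + α / B + y * Real.log t - t)
      = (B + 1) ^ y / (α - 1) ^ y * Real.exp (α / B) * t ^ y * Real.exp (-t) := by
    rw [Real.rpow_def_of_pos (by linarith : 0 < B + 1), Real.rpow_def_of_pos hα1,
      Real.rpow_def_of_pos ht, ← Real.exp_sub, ← Real.exp_add, ← Real.exp_add, ← Real.exp_add]
    congr 1; ring
  have e2 : (B + 1) ^ α ≤ B ^ α * Real.exp (α / B) := by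
    rw [Real.rpow_def_of_pos (by linarith : 0 < B + 1), Real.rpow_def_of_pos hB, ← Real.exp_add,
      Real.exp_le_exp]
    have h1 : Real.log (B + 1) ≤ Real.log B + 1 / B := by
      have h2 := Real.log_le_sub_one_of_pos (show 0 < (B + 1) / B by positivity)
      rw [Real.log_div (by linarith) hB.ne'] at h2
      have : (B + 1) / B - 1 = 1 / B := by field_simp; ring
      linarith
    have : α / B = α * (1 / B) := by ring
    nlinarith
  have e3 : (B + 1) ^ (α + y) / Real.Gamma (α + y) ≤
      (B ^ α * Real.exp (α / B)) * (B + 1) ^ y / (Real.Gamma α * (α - 1) ^ y) := by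
    rw [Real.rpow_add (by linarith : 0 < B + 1)]
    gcongr
  have e4 : t ^ (α + y - 1) * Real.exp (-((B + 1) * t)) =
      t ^ (α - 1) * t ^ y * (Real.exp (-(B * t)) * Real.exp (-t)) := by
    rw [← Real.rpow_add ht, ← Real.exp_add]
    congr 2 <;> ring
  unfold gammaPDF
  rw [e1, e4]
  calc _ ≤ (B ^ α * Real.exp (α / B)) * (B + 1) ^ y / (Real.Gamma α * (α - 1) ^ y) *
        (t ^ (α - 1) * t ^ y * (Real.exp (-(B * t)) * Real.exp (-t))) := by gcongr
    _ = _ := by field_simp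

theorem log_gap (y t : ℝ) (hy : 0 < y) (ht : 0 < t) :
    y * Real.log t - t ≤ y * Real.log y - y - (√t - √y) ^ 2 := by
  have hs : 0 < √t := Real.sqrt_pos.2 ht
  have hr : 0 < √y := Real.sqrt_pos.2 hy
  have h := Real.log_le_sub_one_of_pos (show 0 < √t / √y by positivity)
  rw [Real.log_div hs.ne' hr.ne', Real.log_sqrt ht.le, Real.log_sqrt hy.le] at h
  have h3 : √t ^ 2 = t := Real.sq_sqrt ht.le
  have h4 : √y ^ 2 = y := Real.sq_sqrt hy.le
  have h5 : y * (√t / √y) = √y * √t := by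
    rw [← h4]; field_simp
    rw [h4, h4]
  have h6 := mul_le_mul_of_nonneg_left h hy.le
  nlinarith

open Filter Topology in
theorem L_tendsto (a b y : ℝ) (hy : 0 < y) :
    Tendsto (fun n : ℕ => y * (Real.log (b + n + 1) - Real.log (a + n * y - 1))
      + (a + n * y) / (b + n) + (y * Real.log y - y)) atTop (𝓝 0) := by
  have hinv : Tendsto (fun n : ℕ => ((n : ℝ))⁻¹) atTop (𝓝 0) := tendsto_inv_atTop_nhds_zero_nat
  have hA : Tendsto (fun n : ℕ => (b + n + 1) / (a + n * y - 1)) atTop (𝓝 (1 / y)) := by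
    have : Tendsto (fun n : ℕ => ((b + 1) * (n : ℝ)⁻¹ + 1) / ((a - 1) * (n : ℝ)⁻¹ + y)) atTop
        (𝓝 (((b + 1) * 0 + 1) / ((a - 1) * 0 + y))) :=
      ((hinv.const_mul _).add_const _).div ((hinv.const_mul _).add_const _) (by simpa using hy.ne')
    simp only [mul_zero, zero_add] at this
    refine this.congr' ?_
    filter_upwards [eventually_gt_atTop 0] with n hn
    have hn' : (n : ℝ) ≠ 0 := by positivity
    rw [← mul_div_mul_right _ _ hn']
    congr 1 <;> field_simp <;> ring
  have hB : Tendsto (fun n : ℕ => (a + n * y) / (b + n)) atTop (𝓝 y) := by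
    have : Tendsto (fun n : ℕ => (a * (n : ℝ)⁻¹ + y) / (b * (n : ℝ)⁻¹ + 1)) atTop
        (𝓝 ((a * 0 + y) / (b * 0 + 1))) :=
      ((hinv.const_mul _).add_const _).div ((hinv.const_mul _).add_const _) (by simp)
    simp only [mul_zero, zero_add, div_one] at this
    refine this.congr' ?_
    filter_upwards [eventually_gt_atTop 0] with n hn
    have hn' : (n : ℝ) ≠ 0 := by positivity
    rw [← mul_div_mul_right _ _ hn']
    congr 1 <;> field_simp
  have hlog := hA.log (by positivity)
  have hsum := ((hlog.const_mul y).add hB).add_const (y * Real.log y - y)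
  have h0 : y * Real.log (1 / y) + y + (y * Real.log y - y) = 0 := by
    rw [one_div, Real.log_inv]; ring
  rw [h0] at hsum
  refine hsum.congr' ?_
  have t1 : Tendsto (fun n : ℕ => b + (n : ℝ) + 1) atTop atTop :=
    tendsto_atTop_add_const_right _ _ (tendsto_atTop_add_const_left _ _ tendsto_natCast_atTop_atTop)
  have t2 : Tendsto (fun n : ℕ => a + (n : ℝ) * y - 1) atTop atTop :=
    tendsto_atTop_add_const_right _ _ (tendsto_atTop_add_const_left _ _
      (tendsto_natCast_atTop_atTop.atTop_mul_const hy))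
  filter_upwards [t1.eventually_gt_atTop 0, t2.eventually_gt_atTop 0] with n h1 h2
  rw [Real.log_div h1.ne' h2.ne']

theorem gap_exists (y₀ e θs : ℝ) (hy₀ : 0 < y₀) (he : 0 < e) (hθ : θs < e) :
    ∃ κ : ℝ, 0 < κ ∧ ∀ t s : ℝ, 0 < t → 0 < s → t - s ≤ θs →
      κ ≤ (√t - √(y₀ + e)) ^ 2 + (√s - √y₀) ^ 2 := by
  obtain ⟨δ, hδ, hδe⟩ : ∃ δ : ℝ, 0 < δ ∧ e - 2 * δ = θs := ⟨(e - θs) / 2, by linarith, by ring⟩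
  have h1 : √(y₀ + e - δ) < √(y₀ + e) := Real.sqrt_lt_sqrt_iff_of_pos (by linarith) |>.2 (by linarith)
  have h2 : √y₀ < √(y₀ + δ) := Real.sqrt_lt_sqrt hy₀.le (by linarith)
  refine ⟨min ((√(y₀ + e) - √(y₀ + e - δ)) ^ 2) ((√(y₀ + δ) - √y₀) ^ 2), ?_, ?_⟩
  · apply lt_min
    · have := sub_pos.2 h1; positivity
    · have := sub_pos.2 h2; positivity
  · intro t s ht hs hts
    by_cases h : t ≤ y₀ + e - δ
    · have := Real.sqrt_le_sqrt h
      refine (min_le_left _ _).trans ?_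
      nlinarith [sq_nonneg (√s - √y₀)]
    · have := Real.sqrt_le_sqrt (show y₀ + δ ≤ s by linarith)
      refine (min_le_right _ _).trans ?_
      nlinarith [sq_nonneg (√t - √(y₀ + e))]

theorem gammaPDF_integrableOn (α l : ℝ) (hα : 0 < α) (hl : 0 < l) :
    IntegrableOn (fun t => gammaPDF t α l) (Set.Ioi 0) := by
  have := integrableOn_rpow_mul_exp_neg_mul_rpow (p := 1) (s := α - 1) (b := l)
    (by linarith) one_pos hl
  simp only [Real.rpow_one] at this
  unfold gammaPDF
  simp only [neg_mul] at this
  exact Integrable.const_mul this _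

/-- (Theorem 4) For fixed `ȳ₀ > 0`, `e > 0` and `θ* < e`, the double integral `H(n)`
of the product of the posterior Gamma densities over `{θ₁ - θ₀ ≤ θ*}` is eventually
nonincreasing in `n`. -/
theorem twoArm_count_eventually_nonincreasing (a₁ b₁ a₀ b₀ : ℝ)
    (ha₁ : 0 < a₁) (hb₁ : 0 < b₁) (ha₀ : 0 < a₀) (hb₀ : 0 < b₀)
    (y₀ : ℝ) (hy₀ : 0 < y₀) (e : ℝ) (he : 0 < e) (θs : ℝ) (hθ : θs < e) :
    ∃ N : ℕ, ∀ n : ℕ, N ≤ n →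
      (∫ p in {p : ℝ × ℝ | 0 < p.1 ∧ 0 < p.2 ∧ p.1 - p.2 ≤ θs},
          gammaPDF p.1 (a₁ + (n : ℝ) * (y₀ + e)) (b₁ + (n : ℝ)) *
            gammaPDF p.2 (a₀ + (n : ℝ) * y₀) (b₀ + (n : ℝ))) -
        (∫ p in {p : ℝ × ℝ | 0 < p.1 ∧ 0 < p.2 ∧ p.1 - p.2 ≤ θs},
          gammaPDF p.1 (a₁ + ((n : ℝ) + 1) * (y₀ + e)) (b₁ + (n : ℝ) + 1) *
            gammaPDF p.2 (a₀ + ((n : ℝ) + 1) * y₀) (b₀ + (n : ℝ) + 1)) ≥ 0 := by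
  obtain ⟨κ, hκ, hgap⟩ := gap_exists y₀ e θs hy₀ he hθ
  have hy₁ : 0 < y₀ + e := by linarith
  have hL := (L_tendsto a₁ b₁ (y₀ + e) hy₁).add (L_tendsto a₀ b₀ y₀ hy₀)
  rw [add_zero] at hL
  have t2 : ∀ a y : ℝ, 0 < y → ∀ᶠ n : ℕ in Filter.atTop, 1 < a + (n : ℝ) * y := fun a y hy =>
    (Filter.tendsto_atTop_add_const_left _ _
      (tendsto_natCast_atTop_atTop.atTop_mul_const hy)).eventually_gt_atTop 1
  obtain ⟨N, hN⟩ := Filter.eventually_atTop.1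
    ((hL.eventually_lt_const hκ).and ((t2 a₁ (y₀ + e) hy₁).and (t2 a₀ y₀ hy₀)))
  refine ⟨N, fun n hn => ?_⟩
  obtain ⟨hlt, hA1, hA0⟩ := hN n hn
  have hB1 : 0 < b₁ + (n : ℝ) := by positivity
  have hB0 : 0 < b₀ + (n : ℝ) := by positivity
  have hS : MeasurableSet {p : ℝ × ℝ | 0 < p.1 ∧ 0 < p.2 ∧ p.1 - p.2 ≤ θs} := by
    apply MeasurableSet.inter (measurableSet_lt measurable_const measurable_fst)
    apply MeasurableSet.inter (measurableSet_lt measurable_const measurable_snd)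
    exact measurableSet_le (measurable_fst.sub measurable_snd) measurable_const
  rw [ge_iff_le, sub_nonneg]
  rw [show a₁ + ((n : ℝ) + 1) * (y₀ + e) = (a₁ + n * (y₀ + e)) + (y₀ + e) by ring,
    show a₀ + ((n : ℝ) + 1) * y₀ = (a₀ + n * y₀) + y₀ by ring]
  apply integral_mono_of_nonneg
  · filter_upwards [ae_restrict_mem hS] with p hp
    exact mul_nonneg (gammaPDF_nonneg' _ _ _ hp.1 (by linarith) (by linarith))
      (gammaPDF_nonneg' _ _ _ hp.2.1 (by linarith) (by linarith))
  · have h1 := gammaPDF_integrableOn _ _ (zero_lt_one.trans hA1) hB1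
    have h0 := gammaPDF_integrableOn _ _ (zero_lt_one.trans hA0) hB0
    have h := Integrable.mul_prod h1 h0
    rw [Measure.prod_restrict] at h
    exact IntegrableOn.mono_set (t := Set.Ioi 0 ×ˢ Set.Ioi 0) h (fun p hp => ⟨hp.1, hp.2.1⟩)
  · filter_upwards [ae_restrict_mem hS] with p hp
    obtain ⟨hp1, hp2, hp3⟩ := hp
    have s1 := gammaPDF_step _ _ _ p.1 hA1 hy₁ hB1 hp1
    have s0 := gammaPDF_step _ _ _ p.2 hA0 hy₀ hB0 hp2
    have n1 := gammaPDF_nonneg' p.1 _ _ hp1 (zero_lt_one.trans hA1) hB1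
    have n0 := gammaPDF_nonneg' p.2 _ _ hp2 (zero_lt_one.trans hA0) hB0
    refine (mul_le_mul s1 s0 (gammaPDF_nonneg' _ _ _ hp2 (by linarith) (by linarith))
      (mul_nonneg n1 (Real.exp_pos _).le)).trans ?_
    rw [mul_mul_mul_comm, ← Real.exp_add]
    apply mul_le_of_le_one_right (mul_nonneg n1 n0)
    rw [Real.exp_le_one_iff]
    have g := hgap p.1 p.2 hp1 hp2 hp3
    have l1 := log_gap (y₀ + e) p.1 hy₁ hp1
    have l0 := log_gap y₀ p.2 hy₀ hp2
    linarith
end
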